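/- arXiv:1007.2224 — 3 statements merged into one kernel-verified Lean document; each statement's English description precedes it below -/
import Mathlib

section
/- For any nonnegative integers r_1, r_2, … with ∑_{j≥1} j·r_j = N, the following identity holds: ∑_{(n,π)} ∏_{k∈Λ*} (n_k!)^{−1} exp(−ε(k) n_k − ∑_{j≥1} α_j r_j(π_k)) = ∏_{j≥1} (r_j!)^{−1} ( (e^{−α_j}/j) ∑_{k∈Λ*} e^{−j ε(k)} )^{r_j}, where the sum on the left ranges over all pairs (n, π) with n = (n_k)_{k∈Λ*} nonnegative integers summing to N (finitely many nonzero), π = (π_k)_{k∈Λ*} with π_k ∈ S_{n_k}, subject to the constraint ∑_{k∈Λ*} r_j(π_k) = r_j for every j. Consequently, the marginal distribution of the total cycle numbers (r_j)_j under the Fourier-mode pair measure coincides with the marginal distribution of cycle numbers under the spatial Gibbs measure. -/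
open MeasureTheory Filter Topology ENNReal
open scoped Classical

noncomputable section

/-- `r_j(π)`: the number of cycles of length `j` in `π ∈ S_n`
(fixed points count as cycles of length 1). -/
def cycCount {n : ℕ} (π : Equiv.Perm (Fin n)) (j : ℕ) : ℕ :=
  if j = 1 then n - π.cycleType.sum else Multiset.count j π.cycleType

/-- Euclidean space `ℝ^d`. -/
abbrev Eu (d : ℕ) := EuclideanSpace ℝ (Fin d)

/-- The dual lattice point `z/L ∈ Λ* = L⁻¹ℤ^d`, for `z ∈ ℤ^d`. -/
def dualPt (d : ℕ) (L : ℝ) (z : Fin d → ℤ) : Eu d :=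
  (WithLp.equiv 2 (Fin d → ℝ)).symm (fun i => (z i) / L)

/-- A pair `(n, π)`: occupation numbers `n = (n_k)_{k∈Λ*}` (finitely supported)
together with a family of permutations `π = (π_k)_{k∈Λ*}`, `π_k ∈ S_{n_k}`. -/
def ModePair (d : ℕ) : Type :=
  Σ n : (Fin d → ℤ) →₀ ℕ, ∀ k : Fin d → ℤ, Equiv.Perm (Fin (n k))

theorem ENNReal.prod_tsum_eq_tsum_pi {ι : Type*} [Fintype ι] {A : ι → Type*}
    (f : ∀ i, A i → ℝ≥0∞) :
    ∏ i, ∑' a, f i a = ∑' p : ∀ i, A i, ∏ i, f i (p i) := by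
  suffices h : ∀ (ι : Type _) [Finite ι], ∀ (_ : Fintype ι) (A : ι → Type _) (f : ∀ i, A i → ℝ≥0∞),
      ∏ i, ∑' a, f i a = ∑' p : ∀ i, A i, ∏ i, f i (p i) from h ι _ A f
  intro ι _
  induction ι using Finite.induction_empty_option with
  | @of_equiv α β e ih =>
    intro _ A f
    have := Fintype.ofEquiv β e.symm
    rw [← e.prod_comp, ih this (fun a => A (e a)) (fun a => f (e a)),
      ← (Equiv.piCongrLeft A e).tsum_eq]
    refine tsum_congr fun p => ?_
    rw [← e.prod_comp]
    simp [Equiv.piCongrLeft_apply_apply]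
  | h_empty =>
    intro _ A f
    simp [tsum_fintype]
  | @h_option α _ ih =>
    intro inst A f
    obtain rfl : inst = instFintypeOption := Subsingleton.elim _ _
    rw [Fintype.prod_option, ih _ _ fun a => f (some a), ← Equiv.piOptionEquivProd.symm.tsum_eq,
      ENNReal.tsum_prod', ← ENNReal.tsum_mul_right]
    refine tsum_congr fun a => ?_
    rw [← ENNReal.tsum_mul_left]
    refine tsum_congr fun p => ?_
    rw [Fintype.prod_option]
    rfl

theorem ENNReal.sum_finsuppAntidiag_prod_pow_div_factorial {K : Type*} (y : K → ℝ≥0∞)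
    (m : ℕ) (F : Finset K) :
    ∑ v ∈ F.finsuppAntidiag m, ∏ k ∈ v.support, ((v k).factorial : ℝ≥0∞)⁻¹ * y k ^ v k =
      (m.factorial : ℝ≥0∞)⁻¹ * (∑ k ∈ F, y k) ^ m := by
  rw [Finset.sum_pow_eq_sum_piAntidiag, Finset.mul_sum]
  refine Finset.sum_bij (fun v _ => ⇑v) ?_ (fun _ _ _ _ h => DFunLike.coe_injective h) ?_ ?_
  · intro v hv
    rw [Finset.mem_finsuppAntidiag] at hv
    rw [Finset.mem_piAntidiag]
    exact ⟨hv.1, fun k hk => hv.2 (Finsupp.mem_support_iff.2 hk)⟩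
  · intro g hg
    rw [Finset.mem_piAntidiag] at hg
    refine ⟨Finsupp.onFinset F g hg.2, ?_, rfl⟩
    rw [Finset.mem_finsuppAntidiag]
    exact ⟨hg.1, Finsupp.support_onFinset_subset⟩
  · intro v hv
    rw [Finset.mem_finsuppAntidiag] at hv
    rw [Finset.prod_subset hv.2 (fun k _ hk => by simp [Finsupp.notMem_support_iff.1 hk]),
      Finset.prod_mul_distrib, ← mul_assoc]
    congr 1
    have h := Nat.multinomial_spec F v
    rw [hv.1] at h
    have h' : (∏ k ∈ F, ((v k).factorial : ℝ≥0∞)) * (Nat.multinomial F v : ℝ≥0∞) =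
        (m.factorial : ℝ≥0∞) := by
      rw [← h]; push_cast; rfl
    have h0 : (∏ k ∈ F, ((v k).factorial : ℝ≥0∞)) ≠ 0 :=
      Finset.prod_ne_zero_iff.2 fun k _ => by exact_mod_cast (v k).factorial_ne_zero
    have h1 : (∏ k ∈ F, ((v k).factorial : ℝ≥0∞)) ≠ ⊤ :=
      ENNReal.prod_ne_top fun k _ => ENNReal.natCast_ne_top _
    have hm0 : (m.factorial : ℝ≥0∞) ≠ 0 := by exact_mod_cast m.factorial_ne_zero
    have hm1 : (m.factorial : ℝ≥0∞) ≠ ⊤ := ENNReal.natCast_ne_top _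
    rw [← ENNReal.prod_inv_distrib fun i _ j _ _ => Or.inr (ENNReal.natCast_ne_top _)]
    apply (ENNReal.mul_right_inj h0 h1).1
    rw [ENNReal.mul_inv_cancel h0 h1, mul_left_comm, h', ENNReal.inv_mul_cancel hm0 hm1]

theorem ENNReal.tsum_degree_eq_prod_pow_div_factorial {K : Type*} (y : K → ℝ≥0∞) (m : ℕ) :
    (∑' v : K →₀ ℕ, if v.degree = m then
        ∏ k ∈ v.support, ((v k).factorial : ℝ≥0∞)⁻¹ * y k ^ v k else 0) =
      (m.factorial : ℝ≥0∞)⁻¹ * (∑' k, y k) ^ m := by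
  have hm0 : (m.factorial : ℝ≥0∞)⁻¹ ≠ ⊤ := by
    simpa using m.factorial_ne_zero
  have key : ∀ F : Finset K, (∑ v ∈ F.finsuppAntidiag m, if v.degree = m then
        ∏ k ∈ v.support, ((v k).factorial : ℝ≥0∞)⁻¹ * y k ^ v k else 0) =
      (m.factorial : ℝ≥0∞)⁻¹ * (∑ k ∈ F, y k) ^ m := by
    intro F
    rw [← ENNReal.sum_finsuppAntidiag_prod_pow_div_factorial]
    refine Finset.sum_congr rfl fun v hv => if_pos ?_
    rw [Finset.mem_finsuppAntidiag'] at hv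
    exact hv.1
  apply le_antisymm
  · rw [ENNReal.tsum_eq_iSup_sum]
    refine iSup_le fun t => ?_
    calc _ ≤ ∑ v ∈ (t.biUnion Finsupp.support).finsuppAntidiag m, if v.degree = m then
            ∏ k ∈ v.support, ((v k).factorial : ℝ≥0∞)⁻¹ * y k ^ v k else 0 := by
          rw [← Finset.sum_filter]
          refine (Finset.sum_le_sum_of_subset (t := (t.biUnion Finsupp.support).finsuppAntidiag m)
            fun v hv => ?_).trans (Finset.sum_le_sum fun v hv => ?_)
          · rw [Finset.mem_filter] at hv
            rw [Finset.mem_finsuppAntidiag']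
            exact ⟨hv.2, Finset.subset_biUnion_of_mem Finsupp.support hv.1⟩
          · rw [Finset.mem_finsuppAntidiag'] at hv
            rw [if_pos]
            exact hv.1
      _ ≤ _ := by
          rw [key]
          gcongr
          exact ENNReal.sum_le_tsum _
  · have ht : Tendsto (fun F : Finset K => (m.factorial : ℝ≥0∞)⁻¹ * (∑ k ∈ F, y k) ^ m) atTop
        (𝓝 ((m.factorial : ℝ≥0∞)⁻¹ * (∑' k, y k) ^ m)) :=
      ENNReal.Tendsto.const_mul (((ENNReal.continuous_pow m).tendsto _).comp
        ENNReal.summable.hasSum) (Or.inr hm0)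
    refine le_of_tendsto' ht fun F => ?_
    rw [← key]
    exact ENNReal.sum_le_tsum _

theorem cycCount_eq_zero_of_lt {n : ℕ} (π : Equiv.Perm (Fin n)) {j : ℕ} (h : n < j) :
    cycCount π j = 0 := by
  have hs : π.cycleType.sum ≤ n := by
    simpa using π.sum_cycleType_le
  unfold cycCount
  split_ifs with h1
  · omega
  · rw [Multiset.count_eq_zero]
    intro hj
    have := Multiset.le_sum_of_mem hj
    omega

theorem Multiset.sum_Icc_two_replicate_count (M : Multiset ℕ) (N : ℕ)
    (hM : ∀ a ∈ M, 2 ≤ a ∧ a ≤ N) :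
    ∑ j ∈ Finset.Icc 2 N, Multiset.replicate (M.count j) j = M := by
  ext a
  rw [Multiset.count_sum']
  simp only [Multiset.count_replicate]
  rw [Finset.sum_ite_eq']
  split_ifs with h
  · rfl
  · rw [eq_comm, Multiset.count_eq_zero]
    intro ha
    exact h (Finset.mem_Icc.2 (hM a ha))

theorem cycleType_mem_bounds {n : ℕ} (π : Equiv.Perm (Fin n)) {a : ℕ} (ha : a ∈ π.cycleType) :
    2 ≤ a ∧ a ≤ n := by
  have hs : π.cycleType.sum ≤ n := by
    simpa using π.sum_cycleType_le
  exact ⟨Equiv.Perm.two_le_of_mem_cycleType ha, (Multiset.le_sum_of_mem ha).trans hs⟩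

theorem Finset.Icc_one_eq_insert {N : ℕ} (hN : 1 ≤ N) :
    Finset.Icc 1 N = insert 1 (Finset.Icc 2 N) := by
  ext; simp; omega

theorem sum_mul_cycCount {n : ℕ} (π : Equiv.Perm (Fin n)) {N : ℕ} (h : n ≤ N) :
    ∑ j ∈ Finset.Icc 1 N, j * cycCount π j = n := by
  have hs : π.cycleType.sum ≤ n := by
    simpa using π.sum_cycleType_le
  rcases Nat.eq_zero_or_pos N with rfl | hN
  · simp; omega
  have hM := congrArg Multiset.sum (Multiset.sum_Icc_two_replicate_count π.cycleType N
    fun a ha => (cycleType_mem_bounds π ha).imp id (·.trans h))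
  rw [Multiset.sum_sum] at hM
  rw [Finset.Icc_one_eq_insert hN, Finset.sum_insert (by simp)]
  have : ∑ j ∈ Finset.Icc 2 N, j * cycCount π j = π.cycleType.sum := by
    rw [← hM]
    refine Finset.sum_congr rfl fun j hj => ?_
    have := (Finset.mem_Icc.1 hj).1
    rw [Multiset.sum_replicate, cycCount, if_neg (by omega), smul_eq_mul, mul_comm]
  rw [this, cycCount, if_pos rfl]
  omega

theorem cycCount_eq_iff_cycleType_eq {m N : ℕ} (hm : m ≤ N) (s : ℕ → ℕ)
    (hs : ∑ j ∈ Finset.Icc 1 N, j * s j = m) (π : Equiv.Perm (Fin m)) :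
    (∀ j ∈ Finset.Icc 1 N, s j = cycCount π j) ↔
      π.cycleType = ∑ j ∈ Finset.Icc 2 N, Multiset.replicate (s j) j := by
  constructor
  · intro h
    rw [← Multiset.sum_Icc_two_replicate_count π.cycleType N
      fun a ha => (cycleType_mem_bounds π ha).imp id (·.trans hm)]
    refine Finset.sum_congr rfl fun j hj => ?_
    rw [Finset.mem_Icc] at hj
    rw [h j (Finset.mem_Icc.2 ⟨by omega, hj.2⟩), cycCount, if_neg (by omega)]
  · intro h
    have h2 : ∀ j ∈ Finset.Icc 2 N, s j = cycCount π j := by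
      intro j hj
      have := (Finset.mem_Icc.1 hj).1
      rw [cycCount, if_neg (by omega), h, Multiset.count_sum']
      simp only [Multiset.count_replicate]
      rw [Finset.sum_ite_eq', if_pos hj]
    intro j hj
    have hN : 1 ≤ N := by rw [Finset.mem_Icc] at hj; omega
    have hc := sum_mul_cycCount π hm
    rw [Finset.Icc_one_eq_insert hN] at hj hc hs
    rw [Finset.sum_insert (by simp)] at hc hs
    rcases Finset.mem_insert.1 hj with rfl | hj
    · have : ∑ j ∈ Finset.Icc 2 N, j * s j = ∑ j ∈ Finset.Icc 2 N, j * cycCount π j :=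
        Finset.sum_congr rfl fun j hj => by rw [h2 j hj]
      omega
    · exact h2 j hj

theorem card_cycCount_mul_eq {m N : ℕ} (hm : m ≤ N) (s : ℕ → ℕ)
    (hs : ∑ j ∈ Finset.Icc 1 N, j * s j = m) :
    (Finset.univ.filter fun π : Equiv.Perm (Fin m) =>
        ∀ j ∈ Finset.Icc 1 N, s j = cycCount π j).card *
      ∏ j ∈ Finset.Icc 1 N, j ^ s j * (s j).factorial = m.factorial := by
  simp_rw [cycCount_eq_iff_cycleType_eq hm s hs]
  set M := ∑ j ∈ Finset.Icc 2 N, Multiset.replicate (s j) j with hM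
  have hsum : M.sum = ∑ j ∈ Finset.Icc 2 N, j * s j := by
    rw [hM, Multiset.sum_sum]
    simp [mul_comm]
  have hprod : M.prod = ∏ j ∈ Finset.Icc 2 N, j ^ s j := by
    rw [hM, Multiset.prod_sum]
    simp
  have hcount : ∀ a, M.count a = if a ∈ Finset.Icc 2 N then s a else 0 := by
    intro a
    rw [hM, Multiset.count_sum']
    simp only [Multiset.count_replicate]
    rw [Finset.sum_ite_eq']
  have hmem : ∀ a ∈ M, a ∈ Finset.Icc 2 N := by
    intro a ha
    by_contra h
    have := hcount a
    rw [if_neg h, Multiset.count_eq_zero] at this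
    exact this ha
  have hfac : ∏ a ∈ M.toFinset, (M.count a).factorial =
      ∏ j ∈ Finset.Icc 2 N, (s j).factorial := by
    rw [Finset.prod_subset (s₂ := Finset.Icc 2 N)
      (fun a ha => hmem a (Multiset.mem_toFinset.1 ha))
      (fun a _ ha => by
        rw [Multiset.count_eq_zero.2 fun h => ha (Multiset.mem_toFinset.2 h), Nat.factorial_zero])]
    exact Finset.prod_congr rfl fun j hj => by rw [hcount, if_pos hj]
  have h1 : (m - M.sum).factorial * M.prod * ∏ a ∈ M.toFinset, (M.count a).factorial =
      ∏ j ∈ Finset.Icc 1 N, j ^ s j * (s j).factorial := by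
    rw [hfac, hprod, mul_assoc, ← Finset.prod_mul_distrib]
    rcases Nat.eq_zero_or_pos N with rfl | hN
    · obtain rfl : m = 0 := by omega
      simp
    · rw [Finset.Icc_one_eq_insert hN] at hs ⊢
      rw [Finset.sum_insert (by simp)] at hs
      rw [Finset.prod_insert (by simp), hsum, one_pow, one_mul]
      congr 2
      omega
  have hle : M.sum ≤ m := by
    rw [hsum, ← hs]
    exact Finset.sum_le_sum_of_subset (Finset.Icc_subset_Icc_left (by omega))
  have := Equiv.Perm.card_of_cycleType_mul_eq (Fin m) M
  rw [Fintype.card_fin, h1, if_pos ⟨hle, fun a ha => (Finset.mem_Icc.1 (hmem a ha)).1⟩] at this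
  rw [← this]

theorem sum_perm_weight_eq_prod {m N : ℕ} (hm : m ≤ N) (s : ℕ → ℕ)
    (hs : ∑ j ∈ Finset.Icc 1 N, j * s j = m) (α : ℕ → ℝ) (e : ℝ) :
    (∑ π : Equiv.Perm (Fin m), if ∀ j ∈ Finset.Icc 1 N, s j = cycCount π j then
        (m.factorial : ℝ≥0∞)⁻¹ * ENNReal.ofReal (Real.exp (-(e * m) -
          ∑ j ∈ Finset.Icc 1 m, α j * (cycCount π j : ℝ))) else 0) =
      ∏ j ∈ Finset.Icc 1 N, ((s j).factorial : ℝ≥0∞)⁻¹ *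
        (ENNReal.ofReal (Real.exp (-α j) / j) *
          ENNReal.ofReal (Real.exp (-((j : ℝ) * e)))) ^ s j := by
  have hcard := card_cycCount_mul_eq hm s hs
  set c := (Finset.univ.filter fun π : Equiv.Perm (Fin m) =>
        ∀ j ∈ Finset.Icc 1 N, s j = cycCount π j).card with hc
  have hexp : Real.exp (-(e * m) - ∑ j ∈ Finset.Icc 1 N, α j * (s j : ℝ)) =
      ∏ j ∈ Finset.Icc 1 N, (Real.exp (-α j) * Real.exp (-((j : ℝ) * e))) ^ s j := by
    simp_rw [← Real.exp_add, ← Real.exp_nat_mul]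
    rw [← Real.exp_sum, ← hs]
    congr 1
    push_cast
    rw [Finset.mul_sum, ← Finset.sum_neg_distrib, ← Finset.sum_sub_distrib]
    exact Finset.sum_congr rfl fun j _ => by ring
  have hL : (∑ π : Equiv.Perm (Fin m), if ∀ j ∈ Finset.Icc 1 N, s j = cycCount π j then
        (m.factorial : ℝ≥0∞)⁻¹ * ENNReal.ofReal (Real.exp (-(e * m) -
          ∑ j ∈ Finset.Icc 1 m, α j * (cycCount π j : ℝ))) else 0) =
      c * ((m.factorial : ℝ≥0∞)⁻¹ * ENNReal.ofReal (Real.exp (-(e * m) -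
          ∑ j ∈ Finset.Icc 1 N, α j * (s j : ℝ)))) := by
    rw [hc, ← nsmul_eq_mul, ← Finset.sum_const, Finset.sum_filter]
    refine Finset.sum_congr rfl fun π _ => ?_
    split_ifs with hπ
    on_goal 2 => rfl
    rw [Finset.sum_subset (Finset.Icc_subset_Icc_right hm)]
    · rw [Finset.sum_congr rfl fun j hj => by rw [← hπ j hj]]
    · intro j hj hj'
      rw [Finset.mem_Icc] at hj hj'
      rw [cycCount_eq_zero_of_lt π (by omega)]
      simp
  have hfacinv : ∀ n : ℕ, (n.factorial : ℝ≥0∞)⁻¹ = ENNReal.ofReal ((n.factorial : ℝ)⁻¹) := by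
    intro n
    rw [ENNReal.ofReal_inv_of_pos (by positivity), ENNReal.ofReal_natCast]
  rw [hL, hexp]
  have hR : ∀ j ∈ Finset.Icc 1 N, ((s j).factorial : ℝ≥0∞)⁻¹ *
        (ENNReal.ofReal (Real.exp (-α j) / j) *
          ENNReal.ofReal (Real.exp (-((j : ℝ) * e)))) ^ s j =
      ENNReal.ofReal (((s j).factorial : ℝ)⁻¹ *
        (Real.exp (-α j) / j * Real.exp (-((j : ℝ) * e))) ^ s j) := by
    intro j _
    rw [hfacinv, ← ENNReal.ofReal_mul (by positivity), ← ENNReal.ofReal_pow (by positivity),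
      ← ENNReal.ofReal_mul (by positivity)]
  rw [Finset.prod_congr rfl hR, ← ENNReal.ofReal_prod_of_nonneg (fun j _ => by positivity),
    hfacinv, ← ENNReal.ofReal_natCast c, ← ENNReal.ofReal_mul (by positivity),
    ← ENNReal.ofReal_mul (by positivity)]
  congr 1
  have hcard' : (c : ℝ) * ∏ j ∈ Finset.Icc 1 N, ((j : ℝ) ^ s j * ((s j).factorial : ℝ)) =
      (m.factorial : ℝ) := by
    exact_mod_cast hcard
  have hpos : (∏ j ∈ Finset.Icc 1 N, ((j : ℝ) ^ s j * ((s j).factorial : ℝ))) ≠ 0 := by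
    refine Finset.prod_ne_zero_iff.2 fun j hj => ?_
    have : 0 < j := (Finset.mem_Icc.1 hj).1
    positivity
  have hc' : (c : ℝ) * (m.factorial : ℝ)⁻¹ =
      (∏ j ∈ Finset.Icc 1 N, ((j : ℝ) ^ s j * ((s j).factorial : ℝ)))⁻¹ := by
    have hm0 : (m.factorial : ℝ) ≠ 0 := by positivity
    field_simp
    exact hcard'
  rw [← mul_assoc, hc', ← Finset.prod_inv_distrib, ← Finset.prod_mul_distrib]
  refine Finset.prod_congr rfl fun j _ => ?_
  rw [mul_inv, div_mul_eq_mul_div, div_pow]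
  ring

theorem ENNReal.tsum_pi_prod_finset {K : Type*} {A : K → Type*} (F : Finset K)
    (hne : ∀ k ∉ F, Nonempty (A k)) (hsub : ∀ k ∉ F, Subsingleton (A k))
    (f : ∀ k, A k → ℝ≥0∞) :
    ∑' p : ∀ k, A k, ∏ k ∈ F, f k (p k) = ∏ k ∈ F, ∑' a, f k a := by
  have : ∀ k : { k // k ∉ F }, Nonempty (A k) := fun k => hne k k.2
  have : ∀ k : { k // k ∉ F }, Subsingleton (A k) := fun k => hsub k k.2
  let q : ∀ k : { k // k ∉ F }, A k := fun k => Classical.arbitrary _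
  rw [← Finset.prod_coe_sort F, ENNReal.prod_tsum_eq_tsum_pi,
    ← (Equiv.piEquivPiSubtypeProd (· ∈ F) A).symm.tsum_eq, ENNReal.tsum_prod']
  refine tsum_congr fun p => ?_
  rw [tsum_eq_single q fun q' h => (h (Subsingleton.elim _ _)).elim, ← Finset.prod_coe_sort F]
  refine Finset.prod_congr rfl fun k _ => ?_
  simp [Equiv.piEquivPiSubtypeProd]

theorem tsum_perm_families_weight {K : Type*} (e : K → ℝ) (α : ℕ → ℝ) (N : ℕ)
    (u : Finset.Icc 1 N → K →₀ ℕ) (n : K →₀ ℕ) (hn : n = ∑ j : Finset.Icc 1 N, (j : ℕ) • u j)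
    (hN : ∀ k, n k ≤ N) :
    (∑' π : ∀ k, Equiv.Perm (Fin (n k)), if ∀ j k, u j k = cycCount (π k) j then
        ∏ k ∈ n.support, ((n k).factorial : ℝ≥0∞)⁻¹ *
            ENNReal.ofReal (Real.exp (-(e k * (n k)) -
              ∑ j ∈ Finset.Icc 1 (n k), α j * (cycCount (π k) j : ℝ))) else 0) =
      ∏ j, ∏ k ∈ (u j).support, ((u j k).factorial : ℝ≥0∞)⁻¹ *
        (ENNReal.ofReal (Real.exp (-α j) / (j : ℕ)) *
          ENNReal.ofReal (Real.exp (-((j : ℕ) * e k)))) ^ u j k := by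
  have hnk : ∀ k, n k = ∑ j : Finset.Icc 1 N, (j : ℕ) * u j k := by
    intro k
    rw [hn, Finsupp.finsetSum_apply]
    simp
  have hzero : ∀ k, n k = 0 → ∀ j, u j k = 0 := by
    intro k hk j
    rw [hnk, Finset.sum_eq_zero_iff] at hk
    have := (Finset.mem_Icc.1 j.2).1
    rcases Nat.mul_eq_zero.1 (hk j (Finset.mem_univ _)) with h | h <;> omega
  have hsupp : ∀ j, (u j).support ⊆ n.support := by
    intro j k hk
    rw [Finsupp.mem_support_iff] at hk ⊢
    exact fun h => hk (hzero k h j)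
  have hstep : ∀ π : ∀ k, Equiv.Perm (Fin (n k)),
      (if ∀ j k, u j k = cycCount (π k) j then
        ∏ k ∈ n.support, ((n k).factorial : ℝ≥0∞)⁻¹ *
            ENNReal.ofReal (Real.exp (-(e k * (n k)) -
              ∑ j ∈ Finset.Icc 1 (n k), α j * (cycCount (π k) j : ℝ))) else 0) =
      ∏ k ∈ n.support, if ∀ j, u j k = cycCount (π k) j then ((n k).factorial : ℝ≥0∞)⁻¹ *
            ENNReal.ofReal (Real.exp (-(e k * (n k)) -
              ∑ j ∈ Finset.Icc 1 (n k), α j * (cycCount (π k) j : ℝ))) else 0 := by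
    intro π
    rw [Finset.prod_ite_zero]
    refine if_congr ⟨fun h k _ j => h j k, fun h j k => ?_⟩ rfl rfl
    by_cases hk : k ∈ n.support
    · exact h k hk j
    · rw [Finsupp.notMem_support_iff] at hk
      have := (Finset.mem_Icc.1 j.2).1
      rw [hzero k hk, cycCount_eq_zero_of_lt _ (by omega)]
  rw [tsum_congr hstep, ENNReal.tsum_pi_prod_finset n.support
    (fun k _ => ⟨1⟩)
    (fun k hk => by
      rw [Finsupp.notMem_support_iff.1 hk]
      infer_instance)
    (fun k π => if ∀ j, u j k = cycCount π j then ((n k).factorial : ℝ≥0∞)⁻¹ *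
            ENNReal.ofReal (Real.exp (-(e k * (n k)) -
              ∑ j ∈ Finset.Icc 1 (n k), α j * (cycCount π j : ℝ))) else 0)]
  have hmode : ∀ k ∈ n.support, (∑' π : Equiv.Perm (Fin (n k)),
      if ∀ j, u j k = cycCount π j then ((n k).factorial : ℝ≥0∞)⁻¹ *
            ENNReal.ofReal (Real.exp (-(e k * (n k)) -
              ∑ j ∈ Finset.Icc 1 (n k), α j * (cycCount π j : ℝ))) else 0) =
      ∏ j, ((u j k).factorial : ℝ≥0∞)⁻¹ *
        (ENNReal.ofReal (Real.exp (-α j) / (j : ℕ)) *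
          ENNReal.ofReal (Real.exp (-((j : ℕ) * e k)))) ^ u j k := by
    intro k _
    let s : ℕ → ℕ := fun j => if h : j ∈ Finset.Icc 1 N then u ⟨j, h⟩ k else 0
    have hs : ∀ j : Finset.Icc 1 N, s j = u j k := fun j => dif_pos j.2
    have hsum : ∑ j ∈ Finset.Icc 1 N, j * s j = n k := by
      rw [hnk, ← Finset.sum_coe_sort]
      simp_rw [hs]
    have h := sum_perm_weight_eq_prod (hN k) s hsum α (e k)
    rw [← Finset.prod_coe_sort] at h
    simp_rw [hs] at h
    rw [← h, tsum_fintype]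
    refine Finset.sum_congr rfl fun π _ => ?_
    have hiff : (∀ j, u j k = cycCount π j) ↔ ∀ j ∈ Finset.Icc 1 N, s j = cycCount π j :=
      ⟨fun h j hj => by rw [← h ⟨j, hj⟩, ← hs], fun h j => by rw [← h j j.2, hs]⟩
    simp only [hiff]
    split_ifs <;> rfl
  rw [Finset.prod_congr rfl hmode, Finset.prod_comm]
  refine Finset.prod_congr rfl fun j _ => (Finset.prod_subset (hsupp j) fun k _ hk => ?_).symm
  simp [Finsupp.notMem_support_iff.1 hk]

/-- The cycle numbers `r_j(π_k)`, as a function of the mode `k`. -/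
def modeCycCount {K : Type*} (n : K →₀ ℕ) (π : ∀ k, Equiv.Perm (Fin (n k))) (j : ℕ)
    (hj : 1 ≤ j) : K →₀ ℕ :=
  Finsupp.onFinset n.support (fun k => cycCount (π k) j) fun k hk => by
    rw [Finsupp.mem_support_iff]
    exact fun h => hk (cycCount_eq_zero_of_lt _ (by omega))

theorem degree_modeCycCount {K : Type*} (n : K →₀ ℕ) (π : ∀ k, Equiv.Perm (Fin (n k))) (j : ℕ)
    (hj : 1 ≤ j) :
    (modeCycCount n π j hj).degree = ∑ k ∈ n.support, cycCount (π k) j := by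
  rw [Finsupp.degree_apply]
  exact Finset.sum_subset Finsupp.support_onFinset_subset
    fun k _ hk => Finsupp.notMem_support_iff.1 hk

theorem ite_constraint_eq_tsum {K : Type*} (N : ℕ) (r : ℕ → ℕ) (n : K →₀ ℕ)
    (π : ∀ k, Equiv.Perm (Fin (n k))) (W : ℝ≥0∞) :
    (if (n.sum fun _ m => m) = N ∧
        (∀ j ∈ Finset.Icc 1 N, ∑ k ∈ n.support, cycCount (π k) j = r j) then W else 0) =
      ∑' u : Finset.Icc 1 N → K →₀ ℕ, if ∀ j, (u j).degree = r j then
        if n.degree = N then if ∀ j k, u j k = cycCount (π k) j then W else 0 else 0 else 0 := by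
  let u₀ : Finset.Icc 1 N → K →₀ ℕ := fun j =>
    modeCycCount n π j (Finset.mem_Icc.1 j.2).1
  rw [tsum_eq_single u₀]
  · have h0 : ∀ j k, u₀ j k = cycCount (π k) j := fun j k => rfl
    rw [if_pos h0, ← ite_and]
    have hiff : ((n.sum fun _ m => m) = N ∧
        ∀ j ∈ Finset.Icc 1 N, ∑ k ∈ n.support, cycCount (π k) j = r j) ↔
        (∀ j, (u₀ j).degree = r j) ∧ n.degree = N := by
      refine and_comm.trans (and_congr ⟨fun h j => ?_, fun h j hj => ?_⟩ Iff.rfl)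
      · rw [degree_modeCycCount]
        exact h j j.2
      · rw [← h ⟨j, hj⟩, degree_modeCycCount]
    simp only [hiff]
  · intro u hu
    have : ¬ ∀ j k, u j k = cycCount (π k) j := fun h => hu (by
      ext j k
      exact h j k)
    rw [if_neg this, ite_self, ite_self]

theorem eq_sum_smul_of_cycCount {K : Type*} {N : ℕ} (n : K →₀ ℕ) (hn : n.degree = N)
    (π : ∀ k, Equiv.Perm (Fin (n k))) (u : Finset.Icc 1 N → K →₀ ℕ)
    (h : ∀ j k, u j k = cycCount (π k) j) :
    n = ∑ j : Finset.Icc 1 N, (j : ℕ) • u j := by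
  ext k
  rw [Finsupp.finsetSum_apply]
  simp only [Finsupp.smul_apply, smul_eq_mul, h]
  rw [Finset.sum_coe_sort (Finset.Icc 1 N) fun j => j * cycCount (π k) j,
    sum_mul_cycCount (π k) (hn ▸ Finsupp.le_degree k n)]

theorem tsum_mode_families_eq_prod {K : Type*} (e : K → ℝ) (α : ℕ → ℝ) (N : ℕ) (r : ℕ → ℕ)
    (hrsum : ∑ j ∈ Finset.Icc 1 N, j * r j = N) :
    (∑' p : Σ n : K →₀ ℕ, ∀ k, Equiv.Perm (Fin (n k)),
        if (p.1.sum fun _ m => m) = N ∧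
            (∀ j ∈ Finset.Icc 1 N, ∑ k ∈ p.1.support, cycCount (p.2 k) j = r j) then
          ∏ k ∈ p.1.support, ((p.1 k).factorial : ℝ≥0∞)⁻¹ *
            ENNReal.ofReal (Real.exp (-(e k * (p.1 k)) -
              ∑ j ∈ Finset.Icc 1 (p.1 k), α j * (cycCount (p.2 k) j : ℝ)))
        else 0) =
      ∏ j ∈ Finset.Icc 1 N, ((r j).factorial : ℝ≥0∞)⁻¹ *
        (ENNReal.ofReal (Real.exp (-α j) / j) *
          ∑' k, ENNReal.ofReal (Real.exp (-((j : ℝ) * e k)))) ^ (r j) := by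
  simp_rw [ite_constraint_eq_tsum]
  rw [ENNReal.tsum_comm]
  simp_rw [← ENNReal.tsum_mul_left]
  rw [← Finset.prod_coe_sort]
  simp_rw [← ENNReal.tsum_degree_eq_prod_pow_div_factorial]
  rw [ENNReal.prod_tsum_eq_tsum_pi]
  refine tsum_congr fun u => ?_
  rw [Fintype.prod_ite_zero]
  split_ifs with hu
  on_goal 2 => simp
  have hdeg : (∑ j : Finset.Icc 1 N, (j : ℕ) • u j).degree = N := by
    rw [map_sum]
    simp only [map_nsmul, hu, smul_eq_mul]
    rw [Finset.sum_coe_sort (Finset.Icc 1 N) fun j => j * r j, hrsum]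
  rw [ENNReal.tsum_sigma', tsum_eq_single (∑ j : Finset.Icc 1 N, (j : ℕ) • u j)]
  · simp only [hdeg, if_true]
    exact tsum_perm_families_weight e α N u _ rfl fun k =>
      (Finsupp.le_degree k _).trans hdeg.le
  · intro n hn
    refine ENNReal.tsum_eq_zero.2 fun π => ?_
    dsimp only
    split_ifs with h1 h2
    · exact (hn (eq_sum_smul_of_cycCount n h1 π u h2)).elim
    · rfl
    · rfl

/-- Proposition 3.2: for occupation numbers `(r_j)` with
`∑_{j≥1} j r_j = N`, summing the Fourier-mode pair weights
`∏_{k∈Λ*} (n_k!)⁻¹ exp(-ε(k)n_k - ∑_j α_j r_j(π_k))` over all pairs `(n, π)` with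
`∑_k n_k = N` and `∑_k r_j(π_k) = r_j` for all `j` yields
`∏_{j≥1} (r_j!)⁻¹ ((e^{-α_j}/j) ∑_{k∈Λ*} e^{-jε(k)})^{r_j}`; consequently the marginal
distribution of the total cycle numbers under the Fourier-mode pair measure coincides
with that of the spatial Gibbs measure. -/
theorem statement6
    (d : ℕ) (hd : 1 ≤ d) (L : ℝ) (hL : 0 < L) (ε : Eu d → ℝ)
    (hε0 : ε 0 = 0) (hε_pos : ∀ k : Eu d, k ≠ 0 → 0 < ε k)
    (hε_sum : ∀ j : ℕ, 1 ≤ j →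
      Summable fun z : Fin d → ℤ => Real.exp (-((j : ℝ) * ε (dualPt d L z))))
    (α : ℕ → ℝ) (N : ℕ) (r : ℕ → ℕ)
    (hr0 : ∀ j : ℕ, N < j → r j = 0)
    (hrsum : ∑ j ∈ Finset.Icc 1 N, j * r j = N) :
    (∑' p : ModePair d,
        if (p.1.sum fun _ m => m) = N ∧
            (∀ j ∈ Finset.Icc 1 N, ∑ k ∈ p.1.support, cycCount (p.2 k) j = r j) then
          ∏ k ∈ p.1.support, ((p.1 k).factorial : ℝ≥0∞)⁻¹ *
            ENNReal.ofReal (Real.exp (-(ε (dualPt d L k) * (p.1 k)) -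
              ∑ j ∈ Finset.Icc 1 (p.1 k), α j * (cycCount (p.2 k) j : ℝ)))
        else 0) =
      ∏ j ∈ Finset.Icc 1 N, ((r j).factorial : ℝ≥0∞)⁻¹ *
        (ENNReal.ofReal (Real.exp (-α j) / j) *
          ∑' z : Fin d → ℤ, ENNReal.ofReal (Real.exp (-((j : ℝ) * ε (dualPt d L z))))) ^ (r j) := by
  exact tsum_mode_families_eq_prod (fun z => ε (dualPt d L z)) α N r hrsum
end
end

section
/- Under the stated assumptions, the quantity Ž = ∑_{N≥0} Ž(N), where Ž(N) = ∑_{n∈𝒩_{Λ,N}, n_0 = 0} ∏_{k∈Λ*} e^{−ε(k) n_k} h_{n_k}, is finite and satisfies Ž = exp( ∑_{j≥1} j^{−1} e^{−α_j} ∑_{k∈Λ*, k≠0} e^{−j ε(k)} ). -/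
open MeasureTheory Filter Topology ENNReal
open scoped Classical

noncomputable section

/-- The cycle weight `exp(-∑_{j≥1} α_j r_j(π))` of a permutation `π ∈ S_n`. -/
def permWeight (α : ℕ → ℝ) {n : ℕ} (π : Equiv.Perm (Fin n)) : ℝ :=
  Real.exp (-∑ j ∈ Finset.Icc 1 n, α j * (cycCount π j : ℝ))

/-- `h_n = (n!)⁻¹ ∑_{π ∈ S_n} e^{-∑_{j≥1} α_j r_j(π)}`, with `h_0 = 1`. -/
def hcoef (α : ℕ → ℝ) (n : ℕ) : ℝ :=
  (n.factorial : ℝ)⁻¹ * ∑ π : Equiv.Perm (Fin n), permWeight α π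

/-- The critical density `ρ_c = ∑_{j≥1} e^{-α_j} ∫_{ℝ^d} e^{-jε(k)} dk`. -/
def rhoC (d : ℕ) (ε : Eu d → ℝ) (α : ℕ → ℝ) : ℝ :=
  ∑' j : ℕ, Real.exp (-α (j+1)) * ∫ k : Eu d, Real.exp (-(((j:ℝ)+1) * ε k))

/-- The finite-volume critical density
`ρ_c^{(Λ)} = ∑_{j≥1} e^{-α_j} |Λ|⁻¹ ∑_{k∈Λ*, k≠0} e^{-jε(k)}`. -/
def rhoCL (d : ℕ) (ε : Eu d → ℝ) (α : ℕ → ℝ) (L : ℝ) : ℝ :=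
  ∑' j : ℕ, Real.exp (-α (j+1)) *
    ((L ^ d)⁻¹ * ∑' z : Fin d → ℤ,
      if z = 0 then 0 else Real.exp (-(((j:ℝ)+1) * ε (dualPt d L z))))

/-- `Ž(N)`: the partition function over occupation numbers `(n_k)_{k∈Λ*}` with
`∑_k n_k = N` and `n_0 = 0`, namely `∑_n ∏_{k∈Λ*} e^{-ε(k)n_k} h_{n_k}`
(the product reduces to the support of `n` since `h_0 = 1`). -/
def Zcheck (d : ℕ) (ε : Eu d → ℝ) (α : ℕ → ℝ) (L : ℝ) (N : ℕ) : ℝ≥0∞ :=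
  ∑' n : (Fin d → ℤ) →₀ ℕ,
    if (n.sum fun _ m => m) = N ∧ n 0 = 0 then
      ∏ k ∈ n.support,
        ENNReal.ofReal (Real.exp (-(ε (dualPt d L k) * n k)) * hcoef α (n k))
    else 0

namespace BoseCycles

section Product

variable {ι : Type*}

/-- Splitting off the value at a new point `i` from finitely supported functions. -/
def insertSupportEquiv (i : ι) (s : Finset ι) (hi : i ∉ s) :
    {n : ι →₀ ℕ // n.support ⊆ insert i s} ≃ ℕ × {n : ι →₀ ℕ // n.support ⊆ s} where
  toFun n := (n.1 i, ⟨n.1.erase i, by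
    rw [Finsupp.support_erase, ← Finset.subset_insert_iff]
    exact n.2⟩)
  invFun p := ⟨Finsupp.single i p.1 + p.2.1, by
    refine Finsupp.support_add.trans (Finset.union_subset ?_ ?_)
    · exact Finsupp.support_single_subset.trans (by simp)
    · exact p.2.2.trans (Finset.subset_insert i s)⟩
  left_inv n := Subtype.ext (Finsupp.single_add_erase i n.1)
  right_inv p := by
    obtain ⟨m, n, hn⟩ := p
    have h0 : n i = 0 := Finsupp.notMem_support_iff.mp fun h => hi (hn h)
    refine Prod.ext (by simp [h0]) (Subtype.ext ?_)
    simp [Finsupp.erase_add, Finsupp.erase_of_notMem_support (Finsupp.notMem_support_iff.mpr h0)]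

theorem tsum_support_subset_prod (a : ι → ℕ → ℝ≥0∞) (ha : ∀ i, a i 0 = 1) (s : Finset ι) :
    ∑' n : {n : ι →₀ ℕ // n.support ⊆ s}, n.1.prod a = ∏ i ∈ s, ∑' m, a i m := by
  induction s using Finset.induction_on with
  | empty =>
    rw [tsum_eq_single ⟨0, by simp⟩]
    · simp
    · rintro ⟨n, hn⟩ h
      exact absurd (Subtype.ext (Finsupp.support_eq_empty.mp (Finset.subset_empty.mp hn))) h
  | insert i s hi ih =>
    rw [← (insertSupportEquiv i s hi).symm.tsum_eq, ENNReal.tsum_prod', Finset.prod_insert hi,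
      ← ih, ← ENNReal.tsum_mul_right]
    refine tsum_congr fun m => ?_
    rw [← ENNReal.tsum_mul_left]
    refine tsum_congr fun n => ?_
    have hdisj : Disjoint (Finsupp.single i m).support n.1.support :=
      (Finset.disjoint_singleton_left.mpr fun h => hi (n.2 h)).mono_left
        Finsupp.support_single_subset
    change (Finsupp.single i m + n.1).prod a = _
    rw [Finsupp.prod_add_index_of_disjoint hdisj, Finsupp.prod_single_index (ha i)]

theorem tsum_finsupp_prod (a : ι → ℕ → ℝ≥0∞) (ha : ∀ i, a i 0 = 1) :
    ∑' n : ι →₀ ℕ, n.prod a = ⨆ s : Finset ι, ∏ i ∈ s, ∑' m, a i m := by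
  apply le_antisymm
  · rw [ENNReal.tsum_eq_iSup_sum]
    refine iSup_le fun T => le_iSup_of_le (T.biUnion Finsupp.support) ?_
    rw [← tsum_support_subset_prod a ha,
      ← Finset.sum_subtype_of_mem (p := fun n : ι →₀ ℕ => n.support ⊆ T.biUnion Finsupp.support)
        (fun n => n.prod a) fun n hn => Finset.subset_biUnion_of_mem Finsupp.support hn]
    exact ENNReal.sum_le_tsum _
  · refine iSup_le fun s => ?_
    rw [← tsum_support_subset_prod a ha]
    exact ENNReal.tsum_comp_le_tsum_of_injective Subtype.val_injective fun n : ι →₀ ℕ => n.prod a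

theorem iSup_ofReal_exp_sum (c : ι → ℝ) (hc : ∀ i, 0 ≤ c i) (hs : Summable c) :
    ⨆ s : Finset ι, ENNReal.ofReal (Real.exp (∑ i ∈ s, c i)) =
      ENNReal.ofReal (Real.exp (∑' i, c i)) := by
  refine tendsto_nhds_unique (tendsto_atTop_iSup fun s t hst => ?_) ?_
  · exact ENNReal.ofReal_le_ofReal (Real.exp_le_exp.mpr
      (Finset.sum_le_sum_of_subset_of_nonneg hst fun i _ _ => hc i))
  · exact ((ENNReal.continuous_ofReal.comp Real.continuous_exp).tendsto _).comp hs.hasSum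

theorem tsum_finsupp_prod_eq_exp (a : ι → ℕ → ℝ≥0∞) (ha : ∀ i, a i 0 = 1)
    (c : ι → ℝ) (hc : ∀ i, 0 ≤ c i) (hs : Summable c)
    (hac : ∀ i, ∑' m, a i m = ENNReal.ofReal (Real.exp (c i))) :
    ∑' n : ι →₀ ℕ, n.prod a = ENNReal.ofReal (Real.exp (∑' i, c i)) := by
  rw [tsum_finsupp_prod a ha, ← iSup_ofReal_exp_sum c hc hs]
  refine iSup_congr fun s => ?_
  rw [Real.exp_sum, ENNReal.ofReal_prod_of_nonneg fun _ _ => (Real.exp_pos _).le]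
  exact Finset.prod_congr rfl fun i _ => hac i

theorem tsum_ofReal_pow_div_factorial {x : ℝ} (hx : 0 ≤ x) :
    ∑' m : ℕ, ENNReal.ofReal (x ^ m / m.factorial) = ENNReal.ofReal (Real.exp x) := by
  rw [← ENNReal.ofReal_tsum_of_nonneg (fun m => by positivity) (Real.summable_pow_div_factorial x),
    Real.exp_eq_exp_ℝ, NormedSpace.exp_eq_tsum_div]

end Product

section Permutations

theorem cycCount_eq_count {n : ℕ} (π : Equiv.Perm (Fin n)) (j : ℕ) :
    cycCount π j = π.partition.parts.count j := by
  rw [cycCount, Equiv.Perm.parts_partition, Multiset.count_add, Multiset.count_replicate]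
  split_ifs with h h' h'
  · subst h
    rw [Multiset.count_eq_zero_of_notMem fun h => absurd (Equiv.Perm.two_le_of_mem_cycleType h)
      (by norm_num), Equiv.Perm.sum_cycleType, Fintype.card_fin, zero_add]
  · omega
  · omega
  · rfl

theorem permWeight_eq_prod (α : ℕ → ℝ) {n : ℕ} (π : Equiv.Perm (Fin n)) :
    permWeight α π = ∏ j ∈ π.partition.parts.toFinset,
      Real.exp (-α j) ^ π.partition.parts.count j := by
  have hsub : π.partition.parts.toFinset ⊆ Finset.Icc 1 n := fun j hj => by
    rw [Multiset.mem_toFinset] at hj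
    have h := Nat.Partition.le_of_mem_parts hj
    rw [Fintype.card_fin] at h
    exact Finset.mem_Icc.mpr ⟨π.partition.parts_pos hj, h⟩
  rw [permWeight, ← Finset.sum_neg_distrib, Real.exp_sum]
  rw [Finset.prod_subset hsub]
  · refine Finset.prod_congr rfl fun j _ => ?_
    rw [← Real.exp_nat_mul, cycCount_eq_count]
    ring_nf
  · intro j _ hj
    rw [Multiset.count_eq_zero_of_notMem fun h => hj (Multiset.mem_toFinset.mpr h), pow_zero]

theorem card_parts_eq_mul {n : ℕ} (M : Multiset ℕ) (hM : M.sum = n) (h0 : 0 ∉ M) :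
    (Finset.univ.filter fun π : Equiv.Perm (Fin n) => π.partition.parts = M).card *
      (M.prod * ∏ j ∈ M.toFinset, (M.count j).factorial) = n.factorial := by
  set m := M.filter (2 ≤ ·) with hm
  have hdec : M = m + Multiset.replicate (M.count 1) 1 := by
    ext j
    rw [Multiset.count_add, hm, Multiset.count_filter, Multiset.count_replicate]
    by_cases h1 : j = 1
    · subst h1; simp
    · by_cases hj : j = 0
      · subst hj; simp [Multiset.count_eq_zero_of_notMem h0]
      · simp [Ne.symm h1, show 2 ≤ j by omega]
  have hsum : n = m.sum + M.count 1 := by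
    rw [← hM]
    conv_lhs => rw [hdec]
    simp
  have hprod : M.prod = m.prod := by
    conv_lhs => rw [hdec]
    simp
  have hset : (Finset.univ.filter fun π : Equiv.Perm (Fin n) => π.partition.parts = M) =
      Finset.univ.filter fun π : Equiv.Perm (Fin n) => π.cycleType = m := by
    ext π
    simp only [Finset.mem_filter, Finset.mem_univ, true_and]
    constructor
    · intro h
      rw [← Equiv.Perm.filter_parts_partition_eq_cycleType, h]
    · intro h
      rw [Equiv.Perm.parts_partition, ← Equiv.Perm.sum_cycleType, h, Fintype.card_fin, hsum,
        Nat.add_sub_cancel_left]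
      exact hdec.symm
  have hfac : ∏ j ∈ M.toFinset, (M.count j).factorial =
      (M.count 1).factorial * ∏ j ∈ m.toFinset, (m.count j).factorial := by
    have h1 : 1 ∉ m.toFinset := by simp [hm]
    have hmsub : M.toFinset ⊆ insert 1 m.toFinset := fun j hj => by
      rw [Multiset.mem_toFinset] at hj
      have : j ≠ 0 := fun h => h0 (h ▸ hj)
      rw [Finset.mem_insert, Multiset.mem_toFinset, hm, Multiset.mem_filter]
      by_cases j = 1
      · exact Or.inl ‹_›
      · exact Or.inr ⟨hj, by omega⟩
    rw [Finset.prod_subset hmsub fun j _ hj => by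
      rw [Multiset.count_eq_zero_of_notMem fun h => hj (Multiset.mem_toFinset.mpr h),
        Nat.factorial_zero], Finset.prod_insert h1]
    refine congrArg _ (Finset.prod_congr rfl fun j hj => ?_)
    rw [Multiset.mem_toFinset, hm, Multiset.mem_filter] at hj
    rw [hm, Multiset.count_filter, if_pos hj.2]
  have key := Equiv.Perm.card_of_cycleType_mul_eq (Fin n) m
  rw [Fintype.card_fin, if_pos ⟨by omega, fun j hj => (Multiset.mem_filter.mp hj).2⟩] at key
  rw [hset, hprod, hfac, ← key, show n - m.sum = M.count 1 by omega]
  convert rfl using 1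
  ring_nf

/-- The total weight of the permutations with cycle lengths `M`, divided by `n!`. -/
def partsWeight (α : ℕ → ℝ) (M : Multiset ℕ) : ℝ :=
  (∏ j ∈ M.toFinset, Real.exp (-α j) ^ M.count j) /
    ((M.prod * ∏ j ∈ M.toFinset, (M.count j).factorial : ℕ) : ℝ)

theorem partsWeight_nonneg (α : ℕ → ℝ) (M : Multiset ℕ) : 0 ≤ partsWeight α M := by
  unfold partsWeight
  positivity

theorem partsWeight_of_zero_mem (α : ℕ → ℝ) {M : Multiset ℕ} (h : 0 ∈ M) :
    partsWeight α M = 0 := by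
  rw [partsWeight, Multiset.prod_eq_zero h]
  simp

theorem ofReal_hcoef (α : ℕ → ℝ) (n : ℕ) :
    ENNReal.ofReal (hcoef α n) =
      ∑' M : Multiset ℕ, if M.sum = n then ENNReal.ofReal (partsWeight α M) else 0 := by
  have hpos : ∀ π : Equiv.Perm (Fin n), 0 ≤ (n.factorial : ℝ)⁻¹ * permWeight α π := fun π =>
    mul_nonneg (by positivity) (Real.exp_pos _).le
  rw [hcoef, Finset.mul_sum, ENNReal.ofReal_sum_of_nonneg fun π _ => hpos π]
  have hsplit : ∀ π : Equiv.Perm (Fin n),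
      ENNReal.ofReal ((n.factorial : ℝ)⁻¹ * permWeight α π) =
        ∑' M : Multiset ℕ, if π.partition.parts = M then
          ENNReal.ofReal ((n.factorial : ℝ)⁻¹ * permWeight α π) else 0 := fun π => by
    rw [tsum_eq_single π.partition.parts fun M hM => if_neg (Ne.symm hM), if_pos rfl]
  rw [Finset.sum_congr rfl fun π _ => hsplit π,
    ← Summable.tsum_finsetSum fun _ _ => ENNReal.summable]
  refine tsum_congr fun M => ?_
  rw [← Finset.sum_filter]
  by_cases hM : M.sum = n
  · rw [if_pos hM]
    by_cases h0 : 0 ∈ M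
    · rw [partsWeight_of_zero_mem α h0, Finset.filter_false_of_mem]
      · simp
      · intro π _ h
        exact lt_irrefl 0 (π.partition.parts_pos (h ▸ h0))
    · rw [← ENNReal.ofReal_sum_of_nonneg fun π _ => hpos π]
      congr 1
      rw [Finset.sum_congr rfl (g := fun _ => (n.factorial : ℝ)⁻¹ *
        ∏ j ∈ M.toFinset, Real.exp (-α j) ^ M.count j), Finset.sum_const, nsmul_eq_mul, partsWeight]
      · have hc := card_parts_eq_mul M hM h0
        rw [← hc]
        have hne : n.factorial ≠ 0 := n.factorial_ne_zero
        rw [← hc] at hne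
        have h1 := left_ne_zero_of_mul hne
        have h2 := right_ne_zero_of_mul hne
        rw [Nat.cast_mul]
        have h1' : ((Finset.univ.filter fun π : Equiv.Perm (Fin n) =>
          π.partition.parts = M).card : ℝ) ≠ 0 := Nat.cast_ne_zero.mpr h1
        rw [mul_inv, ← mul_assoc, mul_inv_cancel_left₀ h1', div_eq_inv_mul]
      · intro π hπ
        rw [permWeight_eq_prod, (Finset.mem_filter.mp hπ).2]
  · rw [if_neg hM, Finset.filter_false_of_mem, Finset.sum_empty]
    intro π _ h
    apply hM
    rw [← h, π.partition.parts_sum, Fintype.card_fin]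

theorem pow_sum_mul_partsWeight (α : ℕ → ℝ) (x : ℝ) (M : Multiset ℕ) :
    x ^ M.sum * partsWeight α M =
      ∏ j ∈ M.toFinset, ((j : ℝ)⁻¹ * Real.exp (-α j) * x ^ j) ^ M.count j /
        (M.count j).factorial := by
  rw [partsWeight, Finset.sum_multiset_count, Finset.prod_multiset_count,
    ← Finset.prod_pow_eq_pow_sum]
  push_cast
  rw [← Finset.prod_mul_distrib, ← Finset.prod_div_distrib, ← Finset.prod_mul_distrib]
  refine Finset.prod_congr rfl fun j _ => ?_
  rw [mul_pow, mul_pow, ← pow_mul, smul_eq_mul, inv_pow, mul_comm (M.count j)]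
  simp only [div_eq_mul_inv, mul_inv]
  ring

theorem summable_cycle_series (α : ℕ → ℝ) {C : ℝ} (hC : ∀ j : ℕ, 1 ≤ j → Real.exp (-α j) ≤ C)
    {x : ℝ} (hx : 0 ≤ x) (hx1 : x < 1) :
    Summable fun j : ℕ => (j : ℝ)⁻¹ * Real.exp (-α j) * x ^ j := by
  refine Summable.of_nonneg_of_le (fun j => by positivity) (fun j => ?_)
    ((summable_geometric_of_lt_one hx hx1).mul_left C)
  refine mul_le_mul_of_nonneg_right ?_ (by positivity)
  have hC0 : 0 ≤ C := (Real.exp_pos _).le.trans (hC 1 le_rfl)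
  rcases Nat.eq_zero_or_pos j with rfl | hj
  · simpa using hC0
  · calc (j : ℝ)⁻¹ * Real.exp (-α j) ≤ 1 * C :=
          mul_le_mul (Nat.cast_inv_le_one j) (hC j hj) (Real.exp_pos _).le zero_le_one
      _ = C := one_mul C

theorem hcoef_zero (α : ℕ → ℝ) : hcoef α 0 = 1 := by
  simp [hcoef, permWeight]

/-- The generating function of the coefficients `h_n`. -/
theorem tsum_pow_mul_hcoef (α : ℕ → ℝ) {C : ℝ} (hC : ∀ j : ℕ, 1 ≤ j → Real.exp (-α j) ≤ C)
    {x : ℝ} (hx : 0 ≤ x) (hx1 : x < 1) :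
    ∑' n : ℕ, ENNReal.ofReal (x ^ n * hcoef α n) =
      ENNReal.ofReal (Real.exp (∑' j : ℕ, ((j : ℝ) + 1)⁻¹ * Real.exp (-α (j + 1)) *
        x ^ (j + 1))) := by
  have hs := summable_cycle_series α hC hx hx1
  have hshift := hs.tsum_eq_zero_add
  simp only [Nat.cast_zero, _root_.inv_zero, zero_mul, zero_add, Nat.cast_add, Nat.cast_one] at hshift
  rw [← hshift, ← tsum_finsupp_prod_eq_exp
    (fun (j : ℕ) m => ENNReal.ofReal (((j : ℝ)⁻¹ * Real.exp (-α j) * x ^ j) ^ m / m.factorial))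
    (fun j => by simp) _ (fun j => by positivity) hs
    (fun j => tsum_ofReal_pow_div_factorial (by positivity))]
  calc ∑' n : ℕ, ENNReal.ofReal (x ^ n * hcoef α n)
      = ∑' (n : ℕ) (M : Multiset ℕ),
          if M.sum = n then ENNReal.ofReal (x ^ M.sum * partsWeight α M) else 0 := by
        refine tsum_congr fun n => ?_
        rw [ENNReal.ofReal_mul (by positivity), ofReal_hcoef, ← ENNReal.tsum_mul_left]
        refine tsum_congr fun M => ?_
        split_ifs with h
        · rw [← h, ENNReal.ofReal_mul (by positivity)]
        · simp
    _ = ∑' M : Multiset ℕ, ENNReal.ofReal (x ^ M.sum * partsWeight α M) := by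
        rw [ENNReal.tsum_comm]
        refine tsum_congr fun M => ?_
        rw [tsum_eq_single M.sum fun n hn => if_neg (Ne.symm hn), if_pos rfl]
    _ = _ := by
        rw [← Multiset.toFinsupp.toEquiv.tsum_eq]
        refine tsum_congr fun M => ?_
        rw [pow_sum_mul_partsWeight, ENNReal.ofReal_prod_of_nonneg fun j _ => by positivity]
        rfl

end Permutations

section Lattice

theorem inv_le_norm_dualPt {d : ℕ} {L : ℝ} (hL : 0 < L) {z : Fin d → ℤ} (hz : z ≠ 0) :
    L⁻¹ ≤ ‖dualPt d L z‖ := by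
  obtain ⟨i, hi⟩ := Function.ne_iff.mp hz
  refine le_trans ?_ (PiLp.norm_apply_le (dualPt d L z) i)
  change L⁻¹ ≤ ‖(z i : ℝ) / L‖
  rw [Real.norm_eq_abs, abs_div, abs_of_pos hL, inv_eq_one_div]
  gcongr
  exact_mod_cast Int.one_le_abs hi

/-- The contribution of cycles of length `j + 1` at the dual lattice point `z ≠ 0`. -/
def cycleTerm (d : ℕ) (ε : Eu d → ℝ) (α : ℕ → ℝ) (L : ℝ) (j : ℕ) (z : Fin d → ℤ) : ℝ :=
  ((j : ℝ) + 1)⁻¹ * Real.exp (-α (j + 1)) *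
    if z = 0 then 0 else Real.exp (-(((j : ℝ) + 1) * ε (dualPt d L z)))

theorem cycleTerm_nonneg (d : ℕ) (ε : Eu d → ℝ) (α : ℕ → ℝ) (L : ℝ) (j : ℕ) (z : Fin d → ℤ) :
    0 ≤ cycleTerm d ε α L j z := by
  unfold cycleTerm
  split_ifs <;> positivity

theorem summable_cycleTerm {d : ℕ} {ε : Eu d → ℝ}
    (hε_inf : ∀ δ : ℝ, 0 < δ → ∃ c > (0 : ℝ), ∀ k : Eu d, δ ≤ ‖k‖ → c ≤ ε k)
    {α : ℕ → ℝ} {C : ℝ} (hC : ∀ j : ℕ, 1 ≤ j → Real.exp (-α j) ≤ C) {L : ℝ} (hL : 0 < L)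
    (hlat : Summable fun z : Fin d → ℤ => Real.exp (-ε (dualPt d L z))) :
    Summable fun p : ℕ × (Fin d → ℤ) => cycleTerm d ε α L p.1 p.2 := by
  obtain ⟨c, hc, hcε⟩ := hε_inf L⁻¹ (inv_pos.mpr hL)
  have hgeo : Summable fun j : ℕ => C * Real.exp (-c) ^ j :=
    (summable_geometric_of_lt_one (Real.exp_pos _).le
      (Real.exp_lt_one_iff.mpr (neg_lt_zero.mpr hc))).mul_left C
  have hC0 : 0 ≤ C := (Real.exp_pos _).le.trans (hC 1 le_rfl)
  refine Summable.of_nonneg_of_le (fun p => cycleTerm_nonneg d ε α L p.1 p.2) ?_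
    (hgeo.mul_of_nonneg hlat (fun j => by positivity) fun z => (Real.exp_pos _).le)
  rintro ⟨j, z⟩
  have hw : ((j : ℝ) + 1)⁻¹ * Real.exp (-α (j + 1)) ≤ C := by
    calc ((j : ℝ) + 1)⁻¹ * Real.exp (-α (j + 1)) ≤ 1 * C := by
          refine mul_le_mul ?_ (hC _ (Nat.le_add_left 1 j)) (Real.exp_pos _).le zero_le_one
          exact inv_le_one_of_one_le₀ (by linarith [(Nat.cast_nonneg j : (0 : ℝ) ≤ j)])
      _ = C := one_mul C
  rw [cycleTerm, mul_assoc C]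
  refine mul_le_mul hw ?_ (by split_ifs <;> positivity) hC0
  split_ifs with hz
  · positivity
  · rw [← Real.exp_nat_mul, ← Real.exp_add]
    refine Real.exp_le_exp.mpr ?_
    have h1 := mul_le_mul_of_nonneg_left (hcε _ (inv_le_norm_dualPt hL hz))
      (Nat.cast_nonneg (α := ℝ) j)
    linarith

/-- The weight of `m` particles in the mode `z`, the zero mode being required to be empty. -/
def modeWeight (d : ℕ) (ε : Eu d → ℝ) (α : ℕ → ℝ) (L : ℝ) (z : Fin d → ℤ) (m : ℕ) : ENNReal :=
  if z = 0 ∧ m ≠ 0 then 0 else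
    ENNReal.ofReal (Real.exp (-(ε (dualPt d L z) * m)) * hcoef α m)

theorem modeWeight_zero (d : ℕ) (ε : Eu d → ℝ) (α : ℕ → ℝ) (L : ℝ) (z : Fin d → ℤ) :
    modeWeight d ε α L z 0 = 1 := by
  simp [modeWeight, hcoef_zero]

theorem tsum_Zcheck (d : ℕ) (ε : Eu d → ℝ) (α : ℕ → ℝ) (L : ℝ) :
    ∑' N : ℕ, Zcheck d ε α L N =
      ∑' n : (Fin d → ℤ) →₀ ℕ, n.prod (modeWeight d ε α L) := by
  unfold Zcheck
  rw [ENNReal.tsum_comm]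
  refine tsum_congr fun n => ?_
  rw [tsum_eq_single (n.sum fun _ m => m) fun N hN => if_neg fun h => hN h.1.symm]
  rw [Finsupp.prod]
  by_cases h0 : n 0 = 0
  · rw [if_pos ⟨rfl, h0⟩]
    refine Finset.prod_congr rfl fun k hk => ?_
    rw [modeWeight, if_neg]
    rintro ⟨rfl, h⟩
    exact h h0
  · rw [if_neg fun h => h0 h.2, Finset.prod_eq_zero (Finsupp.mem_support_iff.mpr h0)]
    simp [modeWeight, h0]

theorem tsum_modeWeight {d : ℕ} {ε : Eu d → ℝ}
    (hε_pos : ∀ k : Eu d, k ≠ 0 → 0 < ε k)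
    {α : ℕ → ℝ} {C : ℝ} (hC : ∀ j : ℕ, 1 ≤ j → Real.exp (-α j) ≤ C) {L : ℝ} (hL : 0 < L)
    (z : Fin d → ℤ) :
    ∑' m, modeWeight d ε α L z m =
      ENNReal.ofReal (Real.exp (∑' j, cycleTerm d ε α L j z)) := by
  by_cases hz : z = 0
  · subst hz
    rw [tsum_eq_single 0 fun m hm => by simp [modeWeight, hm], modeWeight_zero]
    simp [cycleTerm]
  · have hne : dualPt d L z ≠ 0 :=
      norm_pos_iff.mp ((inv_pos.mpr hL).trans_le (inv_le_norm_dualPt hL hz))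
    have hgen := tsum_pow_mul_hcoef α hC (Real.exp_pos (-ε (dualPt d L z))).le
      (Real.exp_lt_one_iff.mpr (neg_lt_zero.mpr (hε_pos _ hne)))
    convert hgen using 2
    · refine funext fun m => ?_
      rw [modeWeight, if_neg fun h => hz h.1, ← Real.exp_nat_mul]
      ring_nf
    · congr 1
      refine tsum_congr fun j => ?_
      rw [cycleTerm, if_neg hz, ← Real.exp_nat_mul]
      push_cast
      ring_nf

end Lattice

end BoseCycles

/-- Eq. (4.11): the quantity `Ž = ∑_{N≥0} Ž(N)` is finite and equals
`exp(∑_{j≥1} j⁻¹ e^{-α_j} ∑_{k∈Λ*, k≠0} e^{-jε(k)})`. -/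
theorem statement10
    (d : ℕ) (hd : 1 ≤ d) (ε : Eu d → ℝ)
    -- assumptions on the dispersion relation `ε`
    (hε0 : ε 0 = 0) (hε_nonneg : ∀ k, 0 ≤ ε k) (hε_pos : ∀ k : Eu d, k ≠ 0 → 0 < ε k)
    (hε_uc : UniformContinuous fun k => Real.exp (-ε k))
    (hε_low : ∃ a > (0:ℝ), ∃ η : ℝ, 0 < η ∧ η < d ∧
      ∀ k : Eu d, ‖k‖ ≤ 1 → a * ‖k‖ ^ η ≤ ε k)
    (hε_inf : ∀ δ : ℝ, 0 < δ → ∃ c > (0:ℝ), ∀ k : Eu d, δ ≤ ‖k‖ → c ≤ ε k)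
    -- convergence of the Riemann sums `|Λ|⁻¹ ∑_{k∈Λ*} e^{-ε(k)} → ∫ e^{-ε(k)} dk`
    (hRiemann : Tendsto
      (fun L : ℝ => (L ^ d)⁻¹ * ∑' z : Fin d → ℤ, Real.exp (-ε (dualPt d L z)))
      atTop (𝓝 (∫ k : Eu d, Real.exp (-ε k))))
    -- bounded cycle weights: `sup_j e^{-α_j} < ∞`
    (α : ℕ → ℝ) (hα_bdd : ∃ C : ℝ, ∀ j : ℕ, 1 ≤ j → Real.exp (-α j) ≤ C)
    -- the box, and summability of `e^{-ε}` over the dual lattice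
    (L : ℝ) (hL : 0 < L)
    (hlat : Summable fun z : Fin d → ℤ => Real.exp (-ε (dualPt d L z))) :
    (∑' N : ℕ, Zcheck d ε α L N) ≠ ∞ ∧
      (∑' N : ℕ, Zcheck d ε α L N) =
        ENNReal.ofReal (Real.exp (∑' j : ℕ, ((j:ℝ)+1)⁻¹ * Real.exp (-α (j+1)) *
          ∑' z : Fin d → ℤ,
            if z = 0 then 0 else Real.exp (-(((j:ℝ)+1) * ε (dualPt d L z))))) := by
  obtain ⟨C, hC⟩ := hα_bdd
  have hsum := BoseCycles.summable_cycleTerm hε_inf hC hL hlat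
  have hmain : (∑' N : ℕ, Zcheck d ε α L N) =
      ENNReal.ofReal (Real.exp (∑' j : ℕ, ((j:ℝ)+1)⁻¹ * Real.exp (-α (j+1)) *
        ∑' z : Fin d → ℤ,
          if z = 0 then 0 else Real.exp (-(((j:ℝ)+1) * ε (dualPt d L z))))) := by
    rw [BoseCycles.tsum_Zcheck, BoseCycles.tsum_finsupp_prod_eq_exp _
      (BoseCycles.modeWeight_zero d ε α L) (fun z => ∑' j, BoseCycles.cycleTerm d ε α L j z)
      (fun z => tsum_nonneg fun j => BoseCycles.cycleTerm_nonneg d ε α L j z)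
      hsum.prod_symm.prod (BoseCycles.tsum_modeWeight hε_pos hC hL),
      Summable.tsum_comm (f := BoseCycles.cycleTerm d ε α L) hsum]
    simp only [BoseCycles.cycleTerm, tsum_mul_left]
  exact ⟨hmain ▸ ENNReal.ofReal_ne_top, hmain⟩
end
end

section
/- Under the stated assumptions, the probability measures μ_Λ on [0,∞) converge weakly to the Dirac measure δ_{ρ_c} as L → ∞, where ρ_c = ∑_{j≥1} e^{−α_j} ∫_{ℝ^d} e^{−j ε(k)} dk. -/
open MeasureTheory Filter Topology ENNReal
open scoped Classical

noncomputable section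

/-- The contribution `∏_j (w_j / j)^{m_j} / m_j!` of a cycle type with multiplicities `m_j`. -/
def partTerm (w : ℕ → ℝ) (s : Multiset ℕ) : ℝ :=
  ∏ j ∈ s.toFinset, (w j / j) ^ s.count j / (s.count j).factorial

lemma partTerm_eq_prod (w : ℕ → ℝ) (s : Multiset ℕ) (S : Finset ℕ) (hS : s.toFinset ⊆ S) :
    partTerm w s = ∏ j ∈ S, (w j / j) ^ s.count j / (s.count j).factorial := by
  refine Finset.prod_subset hS fun j _ hj => ?_
  rw [Multiset.mem_toFinset] at hj
  simp [Multiset.count_eq_zero_of_notMem hj]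

lemma partTerm_cons (w : ℕ → ℝ) (s : Multiset ℕ) (a : ℕ) (ha : a ≠ 0) :
    (a : ℝ) * ((s.count a + 1 : ℕ) : ℝ) * partTerm w (a ::ₘ s) = w a * partTerm w s := by
  have haS : a ∈ insert a s.toFinset := Finset.mem_insert_self _ _
  rw [partTerm_eq_prod w (a ::ₘ s) (insert a s.toFinset) (by simp),
    partTerm_eq_prod w s (insert a s.toFinset) (Finset.subset_insert _ _),
    ← Finset.mul_prod_erase _ _ haS, ← Finset.mul_prod_erase _ _ haS]
  have h : ∀ j ∈ (insert a s.toFinset).erase a,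
      (w j / j) ^ (a ::ₘ s).count j / ((a ::ₘ s).count j).factorial =
        (w j / j) ^ s.count j / (s.count j).factorial := by
    intro j hj
    rw [Multiset.count_cons_of_ne (Finset.ne_of_mem_erase hj)]
  rw [Finset.prod_congr rfl h, Multiset.count_cons_self, Nat.factorial_succ, pow_succ]
  have h1 : (a : ℝ) ≠ 0 := Nat.cast_ne_zero.2 ha
  have h2 : ((s.count a).factorial : ℝ) ≠ 0 := Nat.cast_ne_zero.2 (Nat.factorial_ne_zero _)
  push_cast
  field_simp

lemma sum_count_mul_partTerm (w : ℕ → ℝ) {n a : ℕ} (ha1 : 1 ≤ a) (ha : a ≤ n) :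
    ∑ p : n.Partition, (a : ℝ) * (p.parts.count a : ℝ) * partTerm w p.parts =
      w a * ∑ p : (n - a).Partition, partTerm w p.parts := by
  have h : ∑ p : n.Partition, (a : ℝ) * (p.parts.count a : ℝ) * partTerm w p.parts =
      ∑ p : {p : n.Partition // a ∈ p.parts},
        (a : ℝ) * (p.1.parts.count a : ℝ) * partTerm w p.1.parts := by
    rw [← Finset.sum_subtype (Finset.univ.filter fun p : n.Partition => a ∈ p.parts)
      (by simp) (fun p => (a : ℝ) * (p.parts.count a : ℝ) * partTerm w p.parts),
      Finset.sum_filter_of_ne]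
    intro p _ hp
    by_contra hc
    simp [Multiset.count_eq_zero_of_notMem hc] at hp
  rw [h, ← (Nat.Partition.partitionWithPartEquiv ha1 ha).symm.sum_comp, Finset.mul_sum]
  refine Finset.sum_congr rfl fun p _ => ?_
  rw [Nat.Partition.partitionWithPartEquiv_symm_apply_parts, ← partTerm_cons w _ _ (by omega),
    Multiset.count_cons_self]

lemma sum_partTerm_rec (w : ℕ → ℝ) (n : ℕ) :
    (n : ℝ) * ∑ p : n.Partition, partTerm w p.parts =
      ∑ a ∈ Finset.Icc 1 n, w a * ∑ p : (n - a).Partition, partTerm w p.parts := by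
  have h : ∀ p : n.Partition, (n : ℝ) = ∑ a ∈ Finset.Icc 1 n, (a : ℝ) * (p.parts.count a : ℝ) := by
    intro p
    have hsub : p.parts.toFinset ⊆ Finset.Icc 1 n := by
      intro a ha
      rw [Multiset.mem_toFinset] at ha
      exact Finset.mem_Icc.2 ⟨p.parts_pos ha, p.le_of_mem_parts ha⟩
    have := Finset.sum_multiset_count_of_subset p.parts (Finset.Icc 1 n) hsub
    rw [p.parts_sum] at this
    conv_lhs => rw [this]
    push_cast
    refine Finset.sum_congr rfl fun a _ => ?_
    simp [mul_comm]
  rw [Finset.mul_sum]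
  have h' : ∀ p ∈ (Finset.univ : Finset n.Partition), (n : ℝ) * partTerm w p.parts =
      ∑ a ∈ Finset.Icc 1 n, (a : ℝ) * (p.parts.count a : ℝ) * partTerm w p.parts := by
    intro p _
    conv_lhs => rw [h p]
    rw [Finset.sum_mul]
  rw [Finset.sum_congr rfl h', Finset.sum_comm]
  refine Finset.sum_congr rfl fun a ha => ?_
  rw [Finset.mem_Icc] at ha
  exact sum_count_mul_partTerm w ha.1 ha.2

/-- The partition of `n` given by the cycle lengths of `π`, fixed points included. -/
def cyclePartition {n : ℕ} (π : Equiv.Perm (Fin n)) : n.Partition where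
  parts := π.cycleType + Multiset.replicate (n - π.cycleType.sum) 1
  parts_pos {i} hi := by
    rcases Multiset.mem_add.1 hi with hi | hi
    · exact lt_of_lt_of_le zero_lt_two (Equiv.Perm.two_le_of_mem_cycleType hi)
    · rw [Multiset.eq_of_mem_replicate hi]; exact one_pos
  parts_sum := by
    have h := π.sum_cycleType_le
    rw [Fintype.card_fin] at h
    simp [h]

lemma cycCount_eq_count {n : ℕ} (π : Equiv.Perm (Fin n)) (j : ℕ) :
    cycCount π j = (cyclePartition π).parts.count j := by
  unfold cycCount cyclePartition
  rw [Multiset.count_add, Multiset.count_replicate]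
  split_ifs with h1 h2 h2
  · subst h1
    rw [Multiset.count_eq_zero_of_notMem, zero_add]
    intro h
    exact absurd (Equiv.Perm.two_le_of_mem_cycleType h) (by norm_num)
  · exact absurd h1.symm h2
  · exact absurd h2.symm h1
  · simp

lemma filter_cyclePartition {n : ℕ} (π : Equiv.Perm (Fin n)) :
    (cyclePartition π).parts.filter (2 ≤ ·) = π.cycleType := by
  unfold cyclePartition
  rw [Multiset.filter_add, Multiset.filter_eq_self.2 fun _ => Equiv.Perm.two_le_of_mem_cycleType,
    Multiset.filter_eq_nil.2, add_zero]
  intro a ha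
  rw [Multiset.eq_of_mem_replicate ha]
  norm_num

lemma filter_add_replicate_parts {n : ℕ} (p : n.Partition) :
    p.parts.filter (2 ≤ ·) + Multiset.replicate (p.parts.count 1) 1 = p.parts := by
  ext a
  rw [Multiset.count_add, Multiset.count_filter, Multiset.count_replicate]
  rcases Nat.lt_or_ge a 2 with h | h
  · have : a = 0 ∨ a = 1 := by omega
    rcases this with rfl | rfl
    · have : (0 : ℕ) ∉ p.parts := fun h => absurd (p.parts_pos h) (lt_irrefl 0)
      simp [Multiset.count_eq_zero_of_notMem this]
    · simp
  · have : 1 ≠ a := by omega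
    simp [h, this]

lemma sum_filter_parts {n : ℕ} (p : n.Partition) :
    (p.parts.filter (2 ≤ ·)).sum + p.parts.count 1 = n := by
  have := congrArg Multiset.sum (filter_add_replicate_parts p)
  rw [Multiset.sum_add, Multiset.sum_replicate, p.parts_sum] at this
  simpa using this

lemma cyclePartition_eq_iff {n : ℕ} (π : Equiv.Perm (Fin n)) (p : n.Partition) :
    cyclePartition π = p ↔ π.cycleType = p.parts.filter (2 ≤ ·) := by
  constructor
  · rintro rfl
    exact (filter_cyclePartition π).symm
  · intro h
    ext1
    have h1 := sum_filter_parts p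
    rw [← filter_add_replicate_parts p]
    change π.cycleType + Multiset.replicate (n - π.cycleType.sum) 1 = _
    rw [h, ← Nat.eq_sub_of_add_eq' h1]

lemma card_cyclePartition {n : ℕ} (p : n.Partition) :
    (Finset.univ.filter fun π : Equiv.Perm (Fin n) => cyclePartition π = p).card *
      ∏ j ∈ Finset.Icc 1 n, (j ^ p.parts.count j * (p.parts.count j).factorial) =
      n.factorial := by
  have key := Equiv.Perm.card_of_cycleType_mul_eq (Fin n) (p.parts.filter (2 ≤ ·))
  have h1 := sum_filter_parts p
  rw [if_pos ⟨by rw [Fintype.card_fin]; omega, fun a ha => (Multiset.mem_filter.1 ha).2⟩,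
    Fintype.card_fin] at key
  have hset : (Finset.univ.filter fun π : Equiv.Perm (Fin n) => cyclePartition π = p) =
      Finset.univ.filter fun g : Equiv.Perm (Fin n) => g.cycleType = p.parts.filter (2 ≤ ·) := by
    ext π
    simp [cyclePartition_eq_iff]
  rw [hset]
  rw [← key]
  congr 1
  have h2 : n - (p.parts.filter (2 ≤ ·)).sum = p.parts.count 1 := by omega
  have hprod : (p.parts.filter (2 ≤ ·)).prod = p.parts.prod := by
    conv_rhs => rw [← filter_add_replicate_parts p]
    simp
  have hsub : p.parts.toFinset ⊆ Finset.Icc 1 n := by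
    intro a ha
    rw [Multiset.mem_toFinset] at ha
    exact Finset.mem_Icc.2 ⟨p.parts_pos ha, p.le_of_mem_parts ha⟩
  rw [h2, hprod, Finset.prod_mul_distrib, Finset.prod_multiset_count_of_subset _ _ hsub]
  have hfac : ∏ j ∈ Finset.Icc 1 n, (p.parts.count j).factorial =
      (p.parts.count 1).factorial *
        ∏ j ∈ (p.parts.filter (2 ≤ ·)).toFinset, ((p.parts.filter (2 ≤ ·)).count j).factorial := by
    have e1 : ∏ j ∈ (p.parts.filter (2 ≤ ·)).toFinset,
        ((p.parts.filter (2 ≤ ·)).count j).factorial =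
        ∏ j ∈ Finset.Icc 2 n, (p.parts.count j).factorial := by
      have : ∀ j ∈ Finset.Icc 2 n, (p.parts.count j).factorial =
          ((p.parts.filter (2 ≤ ·)).count j).factorial := by
        intro j hj
        rw [Multiset.count_filter, if_pos (Finset.mem_Icc.1 hj).1]
      rw [Finset.prod_congr rfl this]
      refine Finset.prod_subset ?_ ?_
      · intro a ha
        rw [Multiset.mem_toFinset, Multiset.mem_filter] at ha
        exact Finset.mem_Icc.2 ⟨ha.2, p.le_of_mem_parts ha.1⟩
      · intro a _ ha
        rw [Multiset.mem_toFinset] at ha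
        rw [Multiset.count_eq_zero_of_notMem ha, Nat.factorial_zero]
    rw [e1]
    rcases Nat.eq_zero_or_pos n with h0 | h0
    · have hc : p.parts.count 1 = 0 := by omega
      rw [hc]
      subst h0
      simp
    · rw [← Finset.insert_Icc_add_one_left_eq_Icc (show 1 ≤ n from h0), Finset.prod_insert (by simp)]
      rfl
  rw [hfac]
  ring

lemma permWeight_eq (α : ℕ → ℝ) {n : ℕ} (π : Equiv.Perm (Fin n)) :
    permWeight α π =
      ∏ j ∈ Finset.Icc 1 n, Real.exp (-α j) ^ (cyclePartition π).parts.count j := by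
  unfold permWeight
  rw [← Finset.sum_neg_distrib, Real.exp_sum]
  refine Finset.prod_congr rfl fun j _ => ?_
  rw [← Real.exp_nat_mul, cycCount_eq_count]
  congr 1
  ring

lemma hcoef_eq_sum_partTerm (α : ℕ → ℝ) (n : ℕ) :
    hcoef α n = ∑ p : n.Partition, partTerm (fun j => Real.exp (-α j)) p.parts := by
  unfold hcoef
  rw [← Finset.sum_fiberwise Finset.univ (fun π : Equiv.Perm (Fin n) => cyclePartition π),
    Finset.mul_sum]
  refine Finset.sum_congr rfl fun p _ => ?_
  have hw : ∀ π ∈ Finset.univ.filter (fun π : Equiv.Perm (Fin n) => cyclePartition π = p),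
      permWeight α π = ∏ j ∈ Finset.Icc 1 n, Real.exp (-α j) ^ p.parts.count j := by
    intro π hπ
    rw [permWeight_eq, (Finset.mem_filter.1 hπ).2]
  have hsub : p.parts.toFinset ⊆ Finset.Icc 1 n := by
    intro a ha
    rw [Multiset.mem_toFinset] at ha
    exact Finset.mem_Icc.2 ⟨p.parts_pos ha, p.le_of_mem_parts ha⟩
  rw [Finset.sum_congr rfl hw, Finset.sum_const, nsmul_eq_mul, partTerm_eq_prod _ _ _ hsub]
  have hn : (n.factorial : ℝ) ≠ 0 := Nat.cast_ne_zero.2 (Nat.factorial_ne_zero _)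
  have hcard := congrArg (Nat.cast : ℕ → ℝ) (card_cyclePartition p)
  push_cast at hcard
  have hterm : ∀ j ∈ Finset.Icc 1 n,
      (Real.exp (-α j) / j) ^ p.parts.count j / (p.parts.count j).factorial =
        Real.exp (-α j) ^ p.parts.count j /
          ((j : ℝ) ^ p.parts.count j * (p.parts.count j).factorial) := by
    intro j _
    rw [div_pow, div_div]
  have hpos : ∏ j ∈ Finset.Icc 1 n,
      ((j : ℝ) ^ p.parts.count j * ((p.parts.count j).factorial : ℝ)) ≠ 0 := by
    refine Finset.prod_ne_zero_iff.2 fun j hj => ?_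
    have : (j : ℝ) ≠ 0 := Nat.cast_ne_zero.2 (by have := (Finset.mem_Icc.1 hj).1; omega)
    have h2 : ((p.parts.count j).factorial : ℝ) ≠ 0 :=
      Nat.cast_ne_zero.2 (Nat.factorial_ne_zero _)
    positivity
  rw [Finset.prod_congr rfl hterm, Finset.prod_div_distrib, eq_div_iff hpos, inv_mul_eq_div,
    div_mul_eq_mul_div, div_eq_iff hn, ← hcard]
  ring

lemma hcoef_rec (α : ℕ → ℝ) (n : ℕ) :
    (n : ℝ) * hcoef α n = ∑ a ∈ Finset.Icc 1 n, Real.exp (-α a) * hcoef α (n - a) := by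
  simp only [hcoef_eq_sum_partTerm]
  exact sum_partTerm_rec _ n

lemma hcoef_zero (α : ℕ → ℝ) : hcoef α 0 = 1 := by
  simp [hcoef, permWeight]

lemma hcoef_nonneg (α : ℕ → ℝ) (n : ℕ) : 0 ≤ hcoef α n := by
  unfold hcoef permWeight
  positivity

section ProductWeights

variable {ι : Type*} (q b : ι → ℕ → ℝ≥0∞)

/-- The expectation-type sum `∑_n (∏_k q_k(n_k)) f(∑_k n_k)` over finitely supported
occupation numbers. -/
def occSum (f : ℕ → ℝ≥0∞) : ℝ≥0∞ :=
  ∑' n : ι →₀ ℕ, n.prod q * f n.degree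

lemma occSum_mono {f g : ℕ → ℝ≥0∞} (h : ∀ n, f n ≤ g n) : occSum q f ≤ occSum q g :=
  ENNReal.tsum_le_tsum fun _ => by gcongr; exact h _

lemma occSum_add (f g : ℕ → ℝ≥0∞) :
    occSum q (fun n => f n + g n) = occSum q f + occSum q g := by
  simp only [occSum, mul_add, ENNReal.tsum_add]

lemma occSum_const_mul (c : ℝ≥0∞) (f : ℕ → ℝ≥0∞) :
    occSum q (fun n => c * f n) = c * occSum q f := by
  simp only [occSum, ← ENNReal.tsum_mul_left]
  exact tsum_congr fun _ => by ring

lemma occSum_tsum {κ : Type*} (f : κ → ℕ → ℝ≥0∞) :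
    occSum q (fun n => ∑' i, f i n) = ∑' i, occSum q (f i) := by
  simp only [occSum, ← ENNReal.tsum_mul_left]
  exact ENNReal.tsum_comm

variable {q b}

lemma tsum_apply_mul_prod (hq0 : ∀ k, q k 0 = 1)
    (hrec : ∀ k n, ((n : ℕ) : ℝ≥0∞) * q k n = ∑ j ∈ Finset.range n, b k j * q k (n - (j + 1)))
    (f : ℕ → ℝ≥0∞) (k : ι) :
    ∑' n : ι →₀ ℕ, (n k : ℝ≥0∞) * n.prod q * f n.degree =
      ∑' j : ℕ, b k j * occSum q (fun n => f (n + (j + 1))) := by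
  have h1 : ∀ n : ι →₀ ℕ, (n k : ℝ≥0∞) * n.prod q * f n.degree =
      ∑' j : ℕ, b k j * (if j < n k then
        q k (n k - (j + 1)) * (n.erase k).prod q * f n.degree else 0) := by
    intro n
    rw [← Finsupp.mul_prod_erase' n k q hq0, ← mul_assoc, hrec, tsum_eq_sum (s := Finset.range (n k)),
      Finset.sum_mul, Finset.sum_mul]
    · refine Finset.sum_congr rfl fun j hj => ?_
      rw [if_pos (Finset.mem_range.1 hj)]
      ring
    · intro j hj
      rw [if_neg (by simpa using hj), mul_zero]
  rw [tsum_congr h1, ENNReal.tsum_comm]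
  refine tsum_congr fun j => ?_
  rw [ENNReal.tsum_mul_left]
  congr 1
  have hinj : Function.Injective fun m : ι →₀ ℕ => m + Finsupp.single k (j + 1) :=
    add_left_injective _
  rw [← hinj.tsum_eq]
  · refine tsum_congr fun m => ?_
    have e : (m + Finsupp.single k (j + 1)) k = m k + (j + 1) := by simp
    rw [e, if_pos (by omega), Nat.add_sub_cancel, ← Finsupp.mul_prod_erase' m k q hq0]
    congr 2
    · simp [Finsupp.erase_add]
    · simp
  · intro n hn
    have hlt : j < n k := by
      by_contra hc
      simp [hc] at hn
    refine ⟨n - Finsupp.single k (j + 1), ?_⟩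
    refine tsub_add_cancel_of_le ?_
    rw [Finsupp.single_le_iff]
    exact hlt

lemma occSum_mul_degree (hq0 : ∀ k, q k 0 = 1)
    (hrec : ∀ k n, ((n : ℕ) : ℝ≥0∞) * q k n = ∑ j ∈ Finset.range n, b k j * q k (n - (j + 1)))
    (f : ℕ → ℝ≥0∞) :
    occSum q (fun n => n * f n) =
      ∑' k, ∑' j : ℕ, b k j * occSum q (fun n => f (n + (j + 1))) := by
  simp only [← tsum_apply_mul_prod hq0 hrec]
  rw [ENNReal.tsum_comm]
  refine tsum_congr fun n => ?_
  rw [tsum_eq_sum (s := n.support)]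
  · rw [← Finset.sum_mul, ← Finset.sum_mul, Finsupp.degree_apply]
    push_cast
    ring
  · intro k hk
    simp [Finsupp.notMem_support_iff.1 hk]

lemma occSum_le_zero : occSum q (fun n => if n ≤ 0 then 1 else 0) = 1 := by
  unfold occSum
  rw [tsum_eq_single 0]
  · simp
  · intro n hn
    have : ¬ n.degree ≤ 0 := by rwa [Nat.le_zero, Finsupp.degree_eq_zero_iff]
    simp only [if_neg this, mul_zero]

lemma occSum_le_ne_top (hq0 : ∀ k, q k 0 = 1)
    (hrec : ∀ k n, ((n : ℕ) : ℝ≥0∞) * q k n = ∑ j ∈ Finset.range n, b k j * q k (n - (j + 1)))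
    (hm : ∑' k, ∑' j, b k j ≠ ∞) (M : ℕ) :
    occSum q (fun n => if n ≤ M then 1 else 0) ≠ ∞ := by
  induction M with
  | zero => rw [occSum_le_zero]; exact ENNReal.one_ne_top
  | succ M ih =>
    have hle : occSum q (fun n => if n ≤ M + 1 then 1 else 0) ≤
        occSum q (fun n => if n ≤ M then 1 else 0) +
          occSum q (fun n => n * if n = M + 1 then 1 else 0) := by
      rw [← occSum_add]
      refine occSum_mono q fun n => ?_
      rcases Nat.lt_trichotomy n (M + 1) with h | h | h
      · rw [if_pos h.le, if_pos (by omega)]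
        exact le_self_add
      · subst h
        simp
      · rw [if_neg (by omega)]
        exact zero_le
    refine ne_top_of_le_ne_top (ENNReal.add_ne_top.2 ⟨ih, ?_⟩) hle
    rw [occSum_mul_degree hq0 hrec]
    refine ne_top_of_le_ne_top (ENNReal.mul_ne_top hm ih) ?_
    rw [← ENNReal.tsum_mul_right]
    refine ENNReal.tsum_le_tsum fun k => ?_
    rw [← ENNReal.tsum_mul_right]
    refine ENNReal.tsum_le_tsum fun j => ?_
    gcongr
    refine occSum_mono q fun n => ?_
    split_ifs <;> first | omega | simp

lemma occSum_one_ne_top (hq0 : ∀ k, q k 0 = 1)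
    (hrec : ∀ k n, ((n : ℕ) : ℝ≥0∞) * q k n = ∑ j ∈ Finset.range n, b k j * q k (n - (j + 1)))
    (hm : ∑' k, ∑' j, b k j ≠ ∞) :
    occSum q (fun _ => 1) ≠ ∞ := by
  set m := ∑' k, ∑' j, b k j with hmdef
  obtain ⟨R, hR⟩ := ENNReal.exists_nat_gt (ENNReal.mul_ne_top (ENNReal.ofNat_ne_top (n := 2)) hm)
  set A : ℕ → ℝ≥0∞ := fun M => occSum q (fun n => if n ≤ M then 1 else 0) with hA
  have hAfin : ∀ M, A M ≠ ∞ := occSum_le_ne_top hq0 hrec hm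
  have hbound : ∀ M, A M ≤ 2 * A R := by
    intro M
    have hmean : occSum q (fun n => n * if n ≤ M then 1 else 0) ≤ m * A M := by
      rw [occSum_mul_degree hq0 hrec, hmdef, ← ENNReal.tsum_mul_right]
      refine ENNReal.tsum_le_tsum fun k => ?_
      rw [← ENNReal.tsum_mul_right]
      refine ENNReal.tsum_le_tsum fun j => ?_
      gcongr
      refine occSum_mono q fun n => ?_
      split_ifs <;> first | omega | simp
    have hmarkov : R * A M ≤ R * A R + m * A M := by
      refine le_trans ?_ (add_le_add le_rfl hmean)
      rw [hA]
      simp only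
      rw [← occSum_const_mul, ← occSum_const_mul, ← occSum_add]
      refine occSum_mono q fun n => ?_
      split_ifs with h1 h2 h2
      · exact le_self_add
      · simp only [mul_one, mul_zero, zero_add]
        exact_mod_cast (not_le.1 h2).le
      · simp
      · simp
    have h2 : 2 * (R * A M) ≤ 2 * (R * A R) + R * A M := by
      calc 2 * (R * A M) ≤ 2 * (R * A R + m * A M) := by gcongr
        _ = 2 * (R * A R) + (2 * m) * A M := by ring
        _ ≤ _ := by gcongr
    have h3 : R * A M ≤ R * (2 * A R) := by
      rw [two_mul (R * A M : ℝ≥0∞)] at h2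
      have := (ENNReal.add_le_add_iff_right
        (ENNReal.mul_ne_top (ENNReal.natCast_ne_top R) (hAfin M))).1 h2
      calc R * A M ≤ 2 * (R * A R) := this
        _ = _ := by ring
    have hR0 : (R : ℝ≥0∞) ≠ 0 := (lt_of_le_of_lt zero_le hR).ne'
    exact (ENNReal.mul_le_mul_iff_right hR0 (ENNReal.natCast_ne_top R)).1 h3
  have hle : occSum q (fun _ => 1) ≤ 2 * A R := by
    rw [occSum, ENNReal.tsum_eq_iSup_sum]
    refine iSup_le fun s => ?_
    refine le_trans ?_ (hbound (s.sup Finsupp.degree))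
    refine le_trans ?_ (ENNReal.sum_le_tsum s)
    refine Finset.sum_le_sum fun n hn => ?_
    simp only [if_pos (Finset.le_sup (f := Finsupp.degree) hn), le_refl]
  exact ne_top_of_le_ne_top (ENNReal.mul_ne_top ENNReal.ofNat_ne_top (hAfin R)) hle

lemma occSum_mean (hq0 : ∀ k, q k 0 = 1)
    (hrec : ∀ k n, ((n : ℕ) : ℝ≥0∞) * q k n = ∑ j ∈ Finset.range n, b k j * q k (n - (j + 1))) :
    occSum q (fun n => n) = (∑' k, ∑' j, b k j) * occSum q (fun _ => 1) := by
  have := occSum_mul_degree hq0 hrec (fun _ => 1)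
  simp only [mul_one] at this
  rw [this]
  simp only [ENNReal.tsum_mul_right]

lemma occSum_sq (hq0 : ∀ k, q k 0 = 1)
    (hrec : ∀ k n, ((n : ℕ) : ℝ≥0∞) * q k n = ∑ j ∈ Finset.range n, b k j * q k (n - (j + 1))) :
    occSum q (fun n => (n : ℝ≥0∞) ^ 2) =
      ((∑' k, ∑' j, b k j) ^ 2 + ∑' k, ∑' j : ℕ, ((j + 1 : ℕ) : ℝ≥0∞) * b k j) *
        occSum q (fun _ => 1) := by
  have := occSum_mul_degree hq0 hrec (fun n => n)
  simp only [← sq] at this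
  rw [this]
  have h : ∀ k (j : ℕ), b k j * occSum q (fun n => ((n + (j + 1) : ℕ) : ℝ≥0∞)) =
      b k j * ((∑' k, ∑' j, b k j) * occSum q (fun _ => 1)) +
        ((j + 1 : ℕ) : ℝ≥0∞) * b k j * occSum q (fun _ => 1) := by
    intro k j
    have : occSum q (fun n => ((n + (j + 1) : ℕ) : ℝ≥0∞)) =
        occSum q (fun n => n) + ((j + 1 : ℕ) : ℝ≥0∞) * occSum q (fun _ => 1) := by
      rw [← occSum_const_mul, ← occSum_add]
      simp
    rw [this, occSum_mean hq0 hrec]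
    ring
  simp only [h, ENNReal.tsum_add, ENNReal.tsum_mul_right]
  ring

end ProductWeights

lemma hasSum_toReal_of_tsum_eq {β : Type*} {f : β → ℝ≥0∞} {a : ℝ≥0∞} (h : ∑' x, f x = a)
    (ha : a ≠ ∞) : HasSum (fun x => (f x).toReal) a.toReal := by
  subst h
  rw [ENNReal.tsum_toReal_eq (ENNReal.ne_top_of_tsum_ne_top ha)]
  exact ENNReal.hasSum_toReal ha

lemma abs_mean_sub_le_of_moments (p : ℕ → ℝ≥0∞) (g : BoundedContinuousFunction ℝ ℝ)
    {A m V : ℝ≥0∞} (hA0 : A ≠ 0) (hA : A ≠ ∞) (hm : m ≠ ∞) (hV : V ≠ ∞)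
    (h0 : ∑' N, p N = A) (h1 : ∑' N : ℕ, p N * N = m * A)
    (h2 : ∑' N : ℕ, p N * (N : ℝ≥0∞) ^ 2 = (m ^ 2 + V) * A)
    {v ρ e K : ℝ} (hv : 0 < v) (hg : ∀ x, |g x - g ρ| ≤ e + K * (x - ρ) ^ 2) :
    |(∑' N : ℕ, (p N).toReal * g (N / v)) / (∑' N, (p N).toReal) - g ρ| ≤
      e + K * ((m.toReal / v - ρ) ^ 2 + V.toReal / v ^ 2) := by
  have s0 : HasSum (fun N => (p N).toReal) A.toReal := hasSum_toReal_of_tsum_eq h0 hA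
  have s1 : HasSum (fun N : ℕ => (p N).toReal * N) (m.toReal * A.toReal) := by
    simpa using hasSum_toReal_of_tsum_eq h1 (ENNReal.mul_ne_top hm hA)
  have s2 : HasSum (fun N : ℕ => (p N).toReal * (N : ℝ) ^ 2)
      ((m.toReal ^ 2 + V.toReal) * A.toReal) := by
    have hfin : m ^ 2 + V ≠ ∞ := ENNReal.add_ne_top.2 ⟨ENNReal.pow_ne_top hm, hV⟩
    have := hasSum_toReal_of_tsum_eq h2 (ENNReal.mul_ne_top hfin hA)
    rw [ENNReal.toReal_mul, ENNReal.toReal_add (ENNReal.pow_ne_top hm) hV] at this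
    simpa using this
  have hP : 0 < A.toReal := ENNReal.toReal_pos hA0 hA
  have sg : Summable (fun N : ℕ => (p N).toReal * g (N / v)) := by
    refine Summable.of_norm_bounded (s0.summable.mul_right ‖g‖) fun N => ?_
    rw [norm_mul, Real.norm_of_nonneg ENNReal.toReal_nonneg]
    gcongr
    exact g.norm_coe_le_norm _
  have sd : HasSum (fun N : ℕ => (p N).toReal * (g (N / v) - g ρ))
      ((∑' N : ℕ, (p N).toReal * g (N / v)) - A.toReal * g ρ) := by
    simpa only [mul_sub] using sg.hasSum.sub (s0.mul_right (g ρ))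
  have sb : HasSum (fun N : ℕ => (p N).toReal * (e + K * ((N : ℝ) / v - ρ) ^ 2))
      ((e + K * ((m.toReal / v - ρ) ^ 2 + V.toReal / v ^ 2)) * A.toReal) := by
    have := ((s2.mul_left (K / v ^ 2)).add (s1.mul_left (-(2 * K * ρ / v)))).add
      (s0.mul_left (e + K * ρ ^ 2))
    convert! this using 1
    · ext N
      field_simp
      ring
    · field_simp
      ring
  have hab : |(∑' N : ℕ, (p N).toReal * g (N / v)) - A.toReal * g ρ| ≤
      (e + K * ((m.toReal / v - ρ) ^ 2 + V.toReal / v ^ 2)) * A.toReal := by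
    rw [← sd.tsum_eq, ← sb.tsum_eq, ← Real.norm_eq_abs]
    refine tsum_of_norm_bounded sb.summable.hasSum fun N => ?_
    rw [norm_mul, Real.norm_of_nonneg ENNReal.toReal_nonneg, Real.norm_eq_abs]
    exact mul_le_mul_of_nonneg_left (hg _) ENNReal.toReal_nonneg
  have hdiv : (∑' N : ℕ, (p N).toReal * g (N / v)) / A.toReal - g ρ =
      ((∑' N : ℕ, (p N).toReal * g (N / v)) - A.toReal * g ρ) / A.toReal := by
    field_simp
  rw [s0.tsum_eq, hdiv, abs_div, abs_of_pos hP, div_le_iff₀ hP]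
  exact hab

lemma exists_quadratic_bound (g : BoundedContinuousFunction ℝ ℝ) (ρ : ℝ) {e : ℝ} (he : 0 < e) :
    ∃ K, 0 ≤ K ∧ ∀ x, |g x - g ρ| ≤ e + K * (x - ρ) ^ 2 := by
  obtain ⟨δ, hδ, h⟩ := Metric.continuous_iff.1 g.continuous ρ e he
  refine ⟨2 * ‖g‖ / δ ^ 2, by positivity, fun x => ?_⟩
  rcases lt_or_ge (dist x ρ) δ with hx | hx
  · have h1 := h x hx
    rw [Real.dist_eq] at h1
    have : 0 ≤ 2 * ‖g‖ / δ ^ 2 * (x - ρ) ^ 2 := by positivity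
    linarith
  · have h1 : |g x - g ρ| ≤ 2 * ‖g‖ := g.dist_le_two_norm x ρ
    rw [Real.dist_eq] at hx
    have h2 : δ ^ 2 ≤ (x - ρ) ^ 2 := by
      rw [← sq_abs (x - ρ)]
      gcongr
    have h3 : 2 * ‖g‖ ≤ 2 * ‖g‖ / δ ^ 2 * (x - ρ) ^ 2 := by
      rw [div_mul_eq_mul_div, le_div_iff₀ (by positivity)]
      gcongr
    linarith

/-- The weight of occupying the mode `k` with `n` particles, the zero mode being empty. -/
def modeWeight (d : ℕ) (ε : Eu d → ℝ) (α : ℕ → ℝ) (L : ℝ) (k : Fin d → ℤ) (n : ℕ) : ℝ≥0∞ :=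
  if k = 0 then (if n = 0 then 1 else 0)
  else ENNReal.ofReal (Real.exp (-(ε (dualPt d L k) * n)) * hcoef α n)

/-- The density of cycles of length `j + 1` in the mode `k ≠ 0`. -/
def modeCycle (d : ℕ) (ε : Eu d → ℝ) (α : ℕ → ℝ) (L : ℝ) (k : Fin d → ℤ) (j : ℕ) : ℝ≥0∞ :=
  if k = 0 then 0
  else ENNReal.ofReal (Real.exp (-α (j + 1)) * Real.exp (-ε (dualPt d L k)) ^ (j + 1))

section Modes

variable (d : ℕ) (ε : Eu d → ℝ) (α : ℕ → ℝ) (L : ℝ)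

lemma modeWeight_zero (k : Fin d → ℤ) : modeWeight d ε α L k 0 = 1 := by
  simp [modeWeight, hcoef_zero]

lemma modeWeight_rec (k : Fin d → ℤ) (n : ℕ) :
    (n : ℝ≥0∞) * modeWeight d ε α L k n =
      ∑ j ∈ Finset.range n, modeCycle d ε α L k j * modeWeight d ε α L k (n - (j + 1)) := by
  by_cases hk : k = 0
  · rcases Nat.eq_zero_or_pos n with rfl | hn
    · simp
    · simp [modeWeight, modeCycle, hk, hn.ne']
  · simp only [modeWeight, modeCycle, if_neg hk]
    have e1 : ∀ j, ENNReal.ofReal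
          (Real.exp (-α (j + 1)) * Real.exp (-ε (dualPt d L k)) ^ (j + 1)) *
        ENNReal.ofReal (Real.exp (-(ε (dualPt d L k) * ((n - (j + 1) : ℕ) : ℝ))) *
          hcoef α (n - (j + 1))) =
        ENNReal.ofReal ((Real.exp (-α (j + 1)) * Real.exp (-ε (dualPt d L k)) ^ (j + 1)) *
          (Real.exp (-(ε (dualPt d L k) * ((n - (j + 1) : ℕ) : ℝ))) *
          hcoef α (n - (j + 1)))) := fun j => (ENNReal.ofReal_mul (by positivity)).symm
    simp only [e1]
    rw [← ENNReal.ofReal_sum_of_nonneg, ← ENNReal.ofReal_natCast, ← ENNReal.ofReal_mul (by positivity)]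
    · congr 1
      rw [mul_left_comm, hcoef_rec, Finset.mul_sum, ← Finset.Ico_add_one_right_eq_Icc,
        Finset.sum_Ico_eq_sum_range, Nat.add_sub_cancel]
      refine Finset.sum_congr rfl fun j hj => ?_
      have hj' : j + 1 ≤ n := Finset.mem_range.1 hj
      rw [add_comm 1 j, Nat.cast_sub hj']
      have : Real.exp (-(ε (dualPt d L k) * n)) = Real.exp (-ε (dualPt d L k)) ^ (j + 1) *
          Real.exp (-(ε (dualPt d L k) * ((n : ℝ) - ((j + 1 : ℕ) : ℝ)))) := by
        rw [← Real.exp_nat_mul, ← Real.exp_add]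
        congr 1
        push_cast
        ring
      rw [this]
      ring
    · intro j _
      have := hcoef_nonneg α (n - (j + 1))
      positivity

lemma Zcheck_eq_occSum (N : ℕ) :
    Zcheck d ε α L N = occSum (modeWeight d ε α L) (fun n => if n = N then 1 else 0) := by
  unfold Zcheck occSum
  refine tsum_congr fun n => ?_
  have hdeg : (n.sum fun _ m => m) = n.degree := rfl
  rw [hdeg]
  beta_reduce
  by_cases hN : n.degree = N
  · by_cases hn : n 0 = 0
    · rw [if_pos ⟨hN, hn⟩, if_pos hN, mul_one, Finsupp.prod]
      refine Finset.prod_congr rfl fun k hk => ?_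
      have hk0 : k ≠ 0 := by
        rintro rfl
        exact (Finsupp.mem_support_iff.1 hk) hn
      rw [modeWeight, if_neg hk0]
    · rw [if_neg (fun h => hn h.2), Finsupp.prod,
        Finset.prod_eq_zero (Finsupp.mem_support_iff.2 hn), zero_mul]
      simp [modeWeight, hn]
  · rw [if_neg (fun h => hN h.1), if_neg hN, mul_zero]

lemma tsum_Zcheck_mul (f : ℕ → ℝ≥0∞) :
    ∑' N, Zcheck d ε α L N * f N = occSum (modeWeight d ε α L) f := by
  simp only [Zcheck_eq_occSum]
  have h : ∀ N, occSum (modeWeight d ε α L) (fun n => if n = N then 1 else 0) * f N =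
      occSum (modeWeight d ε α L) (fun n => f N * if n = N then 1 else 0) := by
    intro N
    rw [occSum_const_mul, mul_comm]
  simp only [h]
  rw [← occSum_tsum]
  congr 1
  ext n
  rw [tsum_eq_single n]
  · simp
  · intro N hN
    rw [if_neg hN.symm, mul_zero]

end Modes

/-- Concentration of the particle density under the grand-canonical measure without
zero mode, in terms of its mean and variance. -/
lemma abs_ratio_sub_le (d : ℕ) (ε : Eu d → ℝ) (α : ℕ → ℝ) (L : ℝ) (hL : 0 < L)
    (hm : ∑' k, ∑' j, modeCycle d ε α L k j ≠ ∞)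
    (hV : ∑' k, ∑' j : ℕ, ((j + 1 : ℕ) : ℝ≥0∞) * modeCycle d ε α L k j ≠ ∞)
    (g : BoundedContinuousFunction ℝ ℝ) {ρ e K : ℝ}
    (hg : ∀ x, |g x - g ρ| ≤ e + K * (x - ρ) ^ 2) :
    |(∑' N : ℕ, (Zcheck d ε α L N).toReal * g ((N : ℝ) / L ^ d)) /
            (∑' N : ℕ, (Zcheck d ε α L N).toReal) - g ρ| ≤
      e + K * (((∑' k, ∑' j, modeCycle d ε α L k j).toReal / L ^ d - ρ) ^ 2 +
        (∑' k, ∑' j : ℕ, ((j + 1 : ℕ) : ℝ≥0∞) * modeCycle d ε α L k j).toReal /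
          (L ^ d) ^ 2) := by
  have hq0 := modeWeight_zero d ε α L
  have hrec := modeWeight_rec d ε α L
  refine abs_mean_sub_le_of_moments _ g (A := occSum (modeWeight d ε α L) fun _ => 1) ?_
    (occSum_one_ne_top hq0 hrec hm) hm hV ?_ ?_ ?_ (by positivity) hg
  · refine (lt_of_lt_of_le one_pos ((occSum_le_zero (q := modeWeight d ε α L)).symm.le.trans
      (occSum_mono _ fun n => ?_))).ne'
    split_ifs <;> simp
  · simpa using tsum_Zcheck_mul d ε α L fun _ => 1
  · rw [tsum_Zcheck_mul, occSum_mean hq0 hrec]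
  · rw [tsum_Zcheck_mul d ε α L fun N => (N : ℝ≥0∞) ^ 2, occSum_sq hq0 hrec]

lemma tendsto_lintegral_tsub_of_tendsto {X ι : Type*} [MeasurableSpace X] {μ : Measure X}
    {l : Filter ι} [l.IsCountablyGenerated] {f : ι → X → ℝ≥0∞} {f₀ : X → ℝ≥0∞}
    (hf : ∀ i, Measurable (f i)) (hf₀ : Measurable f₀) (hfin : ∫⁻ x, f₀ x ∂μ ≠ ∞)
    (hlim : ∀ᵐ x ∂μ, Tendsto (fun i => f i x) l (𝓝 (f₀ x)))
    (hint : Tendsto (fun i => ∫⁻ x, f i x ∂μ) l (𝓝 (∫⁻ x, f₀ x ∂μ))) :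
    Tendsto (fun i => ∫⁻ x, (f i x - f₀ x) ∂μ) l (𝓝 0) := by
  have hA : Tendsto (fun i => ∫⁻ x, (f₀ x - f i x) ∂μ) l (𝓝 0) := by
    have := tendsto_lintegral_filter_of_dominated_convergence (μ := μ) (l := l)
      (F := fun i x => f₀ x - f i x) (f := fun _ => 0) f₀
      (Eventually.of_forall fun i => hf₀.sub (hf i))
      (Eventually.of_forall fun i => Eventually.of_forall fun x => tsub_le_self) hfin ?_
    · simpa using this
    · filter_upwards [hlim, ae_lt_top hf₀ hfin] with x hx hx'
      simpa using ENNReal.Tendsto.sub (tendsto_const_nhds (x := f₀ x)) hx (Or.inl hx'.ne)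
  have hB : ∀ i, ∫⁻ x, (f i x - f₀ x) ∂μ =
      (∫⁻ x, f i x ∂μ + ∫⁻ x, (f₀ x - f i x) ∂μ) - ∫⁻ x, f₀ x ∂μ := by
    intro i
    rw [← lintegral_add_left (hf i)]
    have : ∀ x, f i x + (f₀ x - f i x) = f₀ x + (f i x - f₀ x) := by
      intro x
      rw [add_tsub_eq_max, add_tsub_eq_max, max_comm]
    simp only [this]
    rw [lintegral_add_left hf₀, ENNReal.add_sub_cancel_left hfin]
  simp only [hB]
  simpa using ENNReal.Tendsto.sub (hint.add hA) (tendsto_const_nhds (x := ∫⁻ x, f₀ x ∂μ))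
    (Or.inr hfin)

/-- Dominated convergence with a dominating family that itself converges in integral. -/
lemma tendsto_lintegral_of_le_add_mul {X ι : Type*} [MeasurableSpace X] {μ : Measure X}
    {l : Filter ι} [l.IsCountablyGenerated] {F f : ι → X → ℝ≥0∞} {F₀ f₀ H : X → ℝ≥0∞}
    {K : ℝ≥0∞} (hF : ∀ i, Measurable (F i)) (hf : ∀ i, Measurable (f i)) (hf₀ : Measurable f₀)
    (hH : Measurable H) (hHfin : ∫⁻ x, H x ∂μ ≠ ∞) (hfin : ∫⁻ x, f₀ x ∂μ ≠ ∞) (hK : K ≠ ∞)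
    (hFlim : ∀ᵐ x ∂μ, Tendsto (fun i => F i x) l (𝓝 (F₀ x)))
    (hlim : ∀ᵐ x ∂μ, Tendsto (fun i => f i x) l (𝓝 (f₀ x)))
    (hint : Tendsto (fun i => ∫⁻ x, f i x ∂μ) l (𝓝 (∫⁻ x, f₀ x ∂μ)))
    (hle : ∀ᶠ i in l, ∀ᵐ x ∂μ, F i x ≤ H x + K * f i x)
    (hle₀ : ∀ᵐ x ∂μ, F₀ x ≤ H x + K * f₀ x) :
    Tendsto (fun i => ∫⁻ x, F i x ∂μ) l (𝓝 (∫⁻ x, F₀ x ∂μ)) ∧ ∫⁻ x, F₀ x ∂μ ≠ ∞ := by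
  set D : X → ℝ≥0∞ := fun x => H x + K * f₀ x with hD
  have hDm : Measurable D := hH.add (hf₀.const_mul K)
  have hDfin : ∫⁻ x, D x ∂μ ≠ ∞ := by
    rw [hD, lintegral_add_left hH, lintegral_const_mul _ hf₀]
    exact ENNReal.add_ne_top.2 ⟨hHfin, ENNReal.mul_ne_top hK hfin⟩
  refine ⟨?_, ne_top_of_le_ne_top hDfin (lintegral_mono_ae hle₀)⟩
  have hmin : Tendsto (fun i => ∫⁻ x, min (F i x) (D x) ∂μ) l (𝓝 (∫⁻ x, F₀ x ∂μ)) := by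
    refine tendsto_lintegral_filter_of_dominated_convergence D
      (Eventually.of_forall fun i => (hF i).min hDm)
      (Eventually.of_forall fun i => Eventually.of_forall fun x => min_le_right _ _) hDfin ?_
    filter_upwards [hFlim, hle₀] with x hx hx'
    have := hx.min (tendsto_const_nhds (x := D x))
    rwa [min_eq_left hx'] at this
  have hsub := tendsto_lintegral_tsub_of_tendsto hf hf₀ hfin hlim hint
  have hup : Tendsto (fun i => ∫⁻ x, min (F i x) (D x) ∂μ + K * ∫⁻ x, (f i x - f₀ x) ∂μ) l
      (𝓝 (∫⁻ x, F₀ x ∂μ)) := by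
    simpa using hmin.add (ENNReal.Tendsto.const_mul hsub (Or.inr hK))
  refine tendsto_of_tendsto_of_tendsto_of_le_of_le' hmin hup
    (Eventually.of_forall fun i => lintegral_mono fun x => min_le_left _ _) ?_
  filter_upwards [hle] with i hi
  rw [← lintegral_const_mul (f := fun x => f i x - f₀ x) _ ((hf i).sub hf₀), ← lintegral_add_left ((hF i).min hDm)]
  refine lintegral_mono_ae ?_
  filter_upwards [hi] with x hix
  rcases le_total (F i x) (D x) with h | h
  · simp only [min_eq_left h]
    exact le_self_add
  · simp only [min_eq_right h]
    calc F i x ≤ H x + K * f i x := hix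
      _ ≤ H x + K * (f₀ x + (f i x - f₀ x)) := by
        gcongr
        exact le_add_tsub
      _ = D x + K * (f i x - f₀ x) := by rw [hD]; ring

section Lattice

/-- The lattice site whose cell of side `1 / L` contains `x`. -/
def cell (d : ℕ) (L : ℝ) (x : Eu d) : Fin d → ℤ := fun i => ⌊L * x i + 1 / 2⌋

lemma measurable_cell (d : ℕ) (L : ℝ) : Measurable (cell d L) := by
  refine measurable_pi_lambda _ fun i => Int.measurable_floor.comp ?_
  fun_prop

lemma volume_cell_preimage (d : ℕ) {L : ℝ} (hL : 0 < L) (z : Fin d → ℤ) :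
    volume (cell d L ⁻¹' {z}) = ENNReal.ofReal ((L ^ d)⁻¹) := by
  have hset : cell d L ⁻¹' {z} = (WithLp.ofLp : Eu d → (Fin d → ℝ)) ⁻¹'
      Set.pi Set.univ fun i => Set.Ico (((z i : ℝ) - 1 / 2) / L) (((z i : ℝ) + 1 / 2) / L) := by
    ext x
    simp only [Set.mem_preimage, Set.mem_singleton_iff, funext_iff, cell, Int.floor_eq_iff,
      Set.mem_pi, Set.mem_univ, true_imp_iff, Set.mem_Ico, div_le_iff₀ hL, lt_div_iff₀ hL]
    refine forall_congr' fun i => ?_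
    constructor <;> rintro ⟨h1, h2⟩ <;> constructor <;> linarith
  rw [hset, (PiLp.volume_preserving_ofLp (Fin d)).measure_preimage
    (MeasurableSet.univ_pi fun i => measurableSet_Ico).nullMeasurableSet, volume_pi_pi]
  have : ∀ i, volume (Set.Ico (((z i : ℝ) - 1 / 2) / L) (((z i : ℝ) + 1 / 2) / L)) =
      ENNReal.ofReal L⁻¹ := by
    intro i
    rw [Real.volume_Ico]
    congr 1
    field_simp
    ring
  simp only [this, Finset.prod_const, Finset.card_univ, Fintype.card_fin]
  rw [← ENNReal.ofReal_pow (by positivity), inv_pow]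

lemma lintegral_cell (d : ℕ) {L : ℝ} (hL : 0 < L) (φ : (Fin d → ℤ) → ℝ≥0∞) :
    ∫⁻ x, φ (cell d L x) = ENNReal.ofReal ((L ^ d)⁻¹) * ∑' z, φ z := by
  rw [← lintegral_map (μ := volume) (measurable_of_countable φ) (measurable_cell d L),
    lintegral_countable', ← ENNReal.tsum_mul_left]
  refine tsum_congr fun z => ?_
  rw [Measure.map_apply (measurable_cell d L) (measurableSet_singleton z),
    volume_cell_preimage d hL, mul_comm]

lemma dualPt_apply (d : ℕ) (L : ℝ) (z : Fin d → ℤ) (i : Fin d) : dualPt d L z i = z i / L := rfl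

lemma norm_dualPt_cell_sub_le (d : ℕ) {L : ℝ} (hL : 0 < L) (x : Eu d) :
    ‖dualPt d L (cell d L x) - x‖ ≤ d / L := by
  have hc : ∀ i, ‖(dualPt d L (cell d L x) - x) i‖ ^ 2 ≤ (1 / L) ^ 2 := by
    intro i
    have h1 := Int.floor_le (L * x i + 1 / 2)
    have h2 := Int.lt_floor_add_one (L * x i + 1 / 2)
    gcongr
    rw [PiLp.sub_apply, dualPt_apply, Real.norm_eq_abs]
    have : ((cell d L x i : ℤ) : ℝ) / L - x i = (((cell d L x i : ℤ) : ℝ) - L * x i) / L := by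
      field_simp
    rw [this, abs_div, abs_of_pos hL]
    gcongr
    rw [cell, abs_le]
    constructor <;> linarith
  rw [EuclideanSpace.norm_eq]
  refine Real.sqrt_le_iff.2 ⟨by positivity, ?_⟩
  refine (Finset.sum_le_sum fun i _ => hc i).trans ?_
  rw [Finset.sum_const, Finset.card_univ, Fintype.card_fin, nsmul_eq_mul, div_pow, div_pow,
    one_pow, mul_one_div]
  gcongr
  exact_mod_cast Nat.le_self_pow two_ne_zero d

lemma one_div_le_norm_dualPt (d : ℕ) {L : ℝ} (hL : 0 < L) {z : Fin d → ℤ} (hz : z ≠ 0) :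
    1 / L ≤ ‖dualPt d L z‖ := by
  obtain ⟨i, hi⟩ := Function.ne_iff.1 hz
  refine le_trans ?_ (PiLp.norm_apply_le (dualPt d L z) i)
  rw [dualPt_apply, norm_div, Real.norm_of_nonneg hL.le]
  gcongr
  rw [Real.norm_eq_abs, ← Int.cast_abs]
  exact_mod_cast Int.one_le_abs hi

lemma norm_le_of_cell_ne_zero (d : ℕ) {L : ℝ} (hL : 0 < L) {x : Eu d} (hx : cell d L x ≠ 0) :
    ‖x‖ ≤ (d + 1) * ‖dualPt d L (cell d L x)‖ := by
  have h1 := one_div_le_norm_dualPt d hL hx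
  have h2 := norm_dualPt_cell_sub_le d hL x
  have h3 : ‖x‖ ≤ ‖dualPt d L (cell d L x)‖ + ‖dualPt d L (cell d L x) - x‖ := by
    have := norm_sub_le (dualPt d L (cell d L x)) (dualPt d L (cell d L x) - x)
    simpa using this
  have h4 : (d : ℝ) / L = d * (1 / L) := by ring
  have h5 : (d : ℝ) * (1 / L) ≤ d * ‖dualPt d L (cell d L x)‖ := by gcongr
  linarith

lemma tendsto_dualPt_cell (d : ℕ) (x : Eu d) :
    Tendsto (fun L : ℝ => dualPt d L (cell d L x)) atTop (𝓝 x) := by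
  rw [tendsto_iff_norm_sub_tendsto_zero]
  refine squeeze_zero' (Eventually.of_forall fun _ => norm_nonneg _)
    ((eventually_gt_atTop 0).mono fun L hL => norm_dualPt_cell_sub_le d hL x) ?_
  exact tendsto_const_nhds.div_atTop tendsto_id

lemma dualPt_zero (d : ℕ) (L : ℝ) : dualPt d L 0 = 0 := by
  ext i
  simp [dualPt_apply]

lemma dualPt_ne_zero (d : ℕ) {L : ℝ} (hL : 0 < L) {z : Fin d → ℤ} (hz : z ≠ 0) :
    dualPt d L z ≠ 0 := by
  have := one_div_le_norm_dualPt d hL hz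
  rw [← norm_pos_iff]
  exact lt_of_lt_of_le (by positivity) this

end Lattice

/-- The cycle series `∑_{j ≥ 1} e^{-α_j} t^j`. -/
def cycleSeries (α : ℕ → ℝ) (t : ℝ) : ℝ≥0∞ :=
  ∑' j : ℕ, ENNReal.ofReal (Real.exp (-α (j + 1)) * t ^ (j + 1))

lemma hasSum_geometric_succ {t : ℝ} (ht0 : 0 ≤ t) (ht : t < 1) :
    HasSum (fun j : ℕ => t ^ (j + 1)) (t / (1 - t)) := by
  simpa only [pow_succ', div_eq_mul_inv] using (hasSum_geometric_of_lt_one ht0 ht).mul_left t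

lemma cycleSeries_le {α : ℕ → ℝ} {C : ℝ} (hC : ∀ j : ℕ, 1 ≤ j → Real.exp (-α j) ≤ C) {t : ℝ}
    (ht0 : 0 ≤ t) (ht : t < 1) : cycleSeries α t ≤ ENNReal.ofReal (C * (t / (1 - t))) := by
  have hC0 : 0 ≤ C := (Real.exp_nonneg _).trans (hC 1 le_rfl)
  have h := (hasSum_geometric_succ ht0 ht).mul_left C
  rw [← h.tsum_eq, ENNReal.ofReal_tsum_of_nonneg (fun j => by positivity) h.summable]
  refine ENNReal.tsum_le_tsum fun j => ENNReal.ofReal_le_ofReal ?_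
  gcongr
  exact hC _ (by omega)

lemma tsum_succ_mul_cycle_le {α : ℕ → ℝ} {C : ℝ} (hC : ∀ j : ℕ, 1 ≤ j → Real.exp (-α j) ≤ C)
    {t : ℝ} (ht0 : 0 ≤ t) (ht : t < 1) :
    ∑' j : ℕ, ((j + 1 : ℕ) : ℝ≥0∞) * ENNReal.ofReal (Real.exp (-α (j + 1)) * t ^ (j + 1)) ≤
      ENNReal.ofReal (C * (t / (1 - t) ^ 2)) := by
  have hC0 : 0 ≤ C := (Real.exp_nonneg _).trans (hC 1 le_rfl)
  have h := (hasSum_coe_mul_geometric_of_norm_lt_one (𝕜 := ℝ) (r := t)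
    (by rwa [Real.norm_of_nonneg ht0])).mul_left C
  rw [← h.tsum_eq, ENNReal.ofReal_tsum_of_nonneg (fun j => by positivity) h.summable]
  refine le_trans ?_ (ENNReal.tsum_comp_le_tsum_of_injective (add_left_injective 1) _)
  refine ENNReal.tsum_le_tsum fun j => ?_
  rw [← ENNReal.ofReal_natCast, ← ENNReal.ofReal_mul (by positivity)]
  refine ENNReal.ofReal_le_ofReal ?_
  have := hC (j + 1) (by omega)
  rw [mul_left_comm]
  gcongr

lemma continuousOn_cycleSeries {α : ℕ → ℝ} {C : ℝ}
    (hC : ∀ j : ℕ, 1 ≤ j → Real.exp (-α j) ≤ C) : ContinuousOn (cycleSeries α) (Set.Ico 0 1) := by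
  intro t ht
  have hC0 : 0 ≤ C := (Real.exp_nonneg _).trans (hC 1 le_rfl)
  obtain ⟨τ, hτ, hτ1⟩ := exists_between ht.2
  have hτ0 : 0 ≤ τ := ht.1.trans hτ.le
  have hbd : ∀ s : ℝ, 0 ≤ s → s ≤ τ → ∀ j : ℕ,
      ‖Real.exp (-α (j + 1)) * s ^ (j + 1)‖ ≤ C * τ ^ (j + 1) := by
    intro s h0 h1 j
    rw [Real.norm_of_nonneg (by positivity)]
    gcongr
    exact hC _ (by omega)
  have hsumm : Summable fun j : ℕ => C * τ ^ (j + 1) :=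
    ((hasSum_geometric_succ hτ0 hτ1).mul_left C).summable
  have hreal : Tendsto (fun s : ℝ => ∑' j : ℕ, Real.exp (-α (j + 1)) * s ^ (j + 1))
      (𝓝[Set.Ico 0 1] t) (𝓝 (∑' j : ℕ, Real.exp (-α (j + 1)) * t ^ (j + 1))) := by
    refine tendsto_tsum_of_dominated_convergence hsumm (fun j => ?_) ?_
    · exact ((continuous_const.mul (continuous_pow (j + 1))).tendsto t).mono_left nhdsWithin_le_nhds
    · filter_upwards [self_mem_nhdsWithin, nhdsWithin_le_nhds (Iio_mem_nhds hτ)] with s hs hs'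
      exact hbd s hs.1 (le_of_lt hs')
  have heq : ∀ s : ℝ, 0 ≤ s → s ≤ τ →
      cycleSeries α s = ENNReal.ofReal (∑' j : ℕ, Real.exp (-α (j + 1)) * s ^ (j + 1)) := by
    intro s h0 h1
    rw [cycleSeries, ENNReal.ofReal_tsum_of_nonneg (fun j => by positivity)
      (Summable.of_norm_bounded hsumm (hbd s h0 h1))]
  rw [ContinuousWithinAt, heq t ht.1 hτ.le]
  refine (ENNReal.tendsto_ofReal hreal).congr' ?_
  filter_upwards [self_mem_nhdsWithin, nhdsWithin_le_nhds (Iio_mem_nhds hτ)] with s hs hs'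
  exact (heq s hs.1 (le_of_lt hs')).symm

section Dispersion

lemma exp_neg_div_le_inv {e : ℝ} (he : 0 < e) : Real.exp (-e) / (1 - Real.exp (-e)) ≤ e⁻¹ := by
  have h1 : Real.exp (-e) < 1 := Real.exp_lt_one_iff.2 (by linarith)
  have h2 : (1 + e) * Real.exp (-e) ≤ 1 := by
    calc (1 + e) * Real.exp (-e) ≤ Real.exp e * Real.exp (-e) := by
          gcongr
          linarith [Real.add_one_le_exp e]
      _ = 1 := by rw [← Real.exp_add]; simp
  rw [div_le_iff₀ (by linarith), inv_mul_eq_div, le_div_iff₀ he]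
  linarith

lemma integrable_indicator_ball_norm_rpow {d : ℕ} (hd : 1 ≤ d) {η : ℝ} (hη : η < d) (r : ℝ) :
    Integrable ((Metric.ball (0 : Eu d) r).indicator fun x => ‖x‖ ^ (-η)) := by
  have : Nonempty (Fin d) := ⟨⟨0, hd⟩⟩
  rw [integrable_indicator_iff measurableSet_ball]
  refine (integrableOn_fun_norm_addHaar (E := Eu d) volume (f := fun y : ℝ => y ^ (-η))).2 ?_
  rcases le_or_gt r 0 with hr | hr
  · simp [Set.Ioo_eq_empty (not_lt.2 hr)]
  have h := (intervalIntegral.integrableOn_Ioo_rpow_iff (s := (d : ℝ) - 1 - η) hr).2 (by linarith)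
  refine h.congr_fun (fun y hy => ?_) measurableSet_Ioo
  have hy0 : 0 < y := hy.1
  rw [smul_eq_mul, finrank_euclideanSpace_fin, ← Real.rpow_natCast, ← Real.rpow_add hy0,
    Nat.cast_sub hd, Nat.cast_one, ← sub_eq_add_neg]

variable {d : ℕ} {ε : Eu d → ℝ}

lemma exp_neg_div_le_of_norm_le (hε_pos : ∀ k : Eu d, k ≠ 0 → 0 < ε k) {a η c : ℝ} (ha : 0 < a)
    (hη : 0 < η) (hlow : ∀ k : Eu d, ‖k‖ ≤ 1 → a * ‖k‖ ^ η ≤ ε k) (hc : 0 < c)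
    (hinf : ∀ k : Eu d, 1 ≤ ‖k‖ → c ≤ ε k) {B : ℝ} (hB : 0 < B) {x k : Eu d} (hx : x ≠ 0)
    (hk : k ≠ 0) (hxk : ‖x‖ ≤ B * ‖k‖) :
    Real.exp (-ε k) / (1 - Real.exp (-ε k)) ≤
      B ^ η / a * (Metric.ball (0 : Eu d) (B + 1)).indicator (fun x => ‖x‖ ^ (-η)) x +
        (1 - Real.exp (-c))⁻¹ * Real.exp (-ε k) := by
  have hk0 : 0 < ‖k‖ := norm_pos_iff.2 hk
  have hx0 : 0 < ‖x‖ := norm_pos_iff.2 hx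
  have hc1 : 0 < 1 - Real.exp (-c) := by
    have : Real.exp (-c) < 1 := Real.exp_lt_one_iff.2 (by linarith)
    linarith
  rcases le_or_gt ‖k‖ 1 with h1 | h1
  · have hmem : x ∈ Metric.ball (0 : Eu d) (B + 1) := by
      rw [mem_ball_zero_iff]
      nlinarith
    rw [Set.indicator_of_mem hmem]
    have h2 : Real.exp (-ε k) / (1 - Real.exp (-ε k)) ≤ (a * ‖k‖ ^ η)⁻¹ :=
      (exp_neg_div_le_inv (hε_pos k hk)).trans
        (inv_anti₀ (by positivity) (hlow k h1))
    have h3 : (a * ‖k‖ ^ η)⁻¹ ≤ B ^ η / a * ‖x‖ ^ (-η) := by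
      rw [Real.rpow_neg hx0.le, ← div_eq_mul_inv, div_div, inv_eq_one_div,
        div_le_div_iff₀ (by positivity) (by positivity)]
      have h4 : ‖x‖ ^ η ≤ B ^ η * ‖k‖ ^ η := by
        rw [← Real.mul_rpow hB.le hk0.le]
        exact Real.rpow_le_rpow hx0.le hxk hη.le
      nlinarith
    have h5 : 0 ≤ (1 - Real.exp (-c))⁻¹ * Real.exp (-ε k) := by positivity
    linarith
  · have h2 : 0 ≤ B ^ η / a *
        (Metric.ball (0 : Eu d) (B + 1)).indicator (fun x => ‖x‖ ^ (-η)) x := by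
      refine mul_nonneg (by positivity) (Set.indicator_nonneg (fun y _ => by positivity) x)
    have h3 : Real.exp (-ε k) / (1 - Real.exp (-ε k)) ≤
        (1 - Real.exp (-c))⁻¹ * Real.exp (-ε k) := by
      rw [div_eq_inv_mul]
      have := hinf k h1.le
      gcongr
    linarith

lemma lintegral_exp_dualPt_cell {L : ℝ} (hL : 0 < L)
    (hsum : Summable fun z : Fin d → ℤ => Real.exp (-ε (dualPt d L z))) :
    ∫⁻ x, ENNReal.ofReal (Real.exp (-ε (dualPt d L (cell d L x)))) =
      ENNReal.ofReal ((L ^ d)⁻¹ * ∑' z : Fin d → ℤ, Real.exp (-ε (dualPt d L z))) := by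
  rw [lintegral_cell d hL fun z => ENNReal.ofReal (Real.exp (-ε (dualPt d L z))),
    ENNReal.ofReal_mul (by positivity),
    ENNReal.ofReal_tsum_of_nonneg (fun _ => Real.exp_nonneg _) hsum]

lemma measurable_comp_cell {β : Type*} [MeasurableSpace β] (φ : (Fin d → ℤ) → β) (L : ℝ) :
    Measurable fun x => φ (cell d L x) :=
  (measurable_of_countable φ).comp (measurable_cell d L)

lemma tendsto_exp_dualPt_cell (hcont : Continuous fun k => Real.exp (-ε k)) (x : Eu d) :
    Tendsto (fun L : ℝ => Real.exp (-ε (dualPt d L (cell d L x)))) atTop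
      (𝓝 (Real.exp (-ε x))) :=
  (hcont.tendsto x).comp (tendsto_dualPt_cell d x)

lemma tendsto_lintegral_exp_cell (hcont : Continuous fun k => Real.exp (-ε k))
    (hRiemann : Tendsto
      (fun L : ℝ => (L ^ d)⁻¹ * ∑' z : Fin d → ℤ, Real.exp (-ε (dualPt d L z)))
      atTop (𝓝 (∫ k : Eu d, Real.exp (-ε k))))
    (hlat : ∀ L : ℝ, 0 < L → Summable fun z : Fin d → ℤ => Real.exp (-ε (dualPt d L z))) :
    ∫⁻ x, ENNReal.ofReal (Real.exp (-ε x)) ≠ ∞ ∧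
      Tendsto (fun L : ℝ => ∫⁻ x, ENNReal.ofReal (Real.exp (-ε (dualPt d L (cell d L x))))) atTop
        (𝓝 (∫⁻ x, ENNReal.ofReal (Real.exp (-ε x)))) := by
  have hlim : Tendsto
      (fun L : ℝ => ∫⁻ x, ENNReal.ofReal (Real.exp (-ε (dualPt d L (cell d L x))))) atTop
      (𝓝 (ENNReal.ofReal (∫ k : Eu d, Real.exp (-ε k)))) := by
    refine (ENNReal.tendsto_ofReal hRiemann).congr' ?_
    filter_upwards [eventually_gt_atTop 0] with L hL
    exact (lintegral_exp_dualPt_cell hL (hlat L hL)).symm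
  have hfatou : ∫⁻ x, ENNReal.ofReal (Real.exp (-ε x)) ≤
      ENNReal.ofReal (∫ k : Eu d, Real.exp (-ε k)) := by
    have h := lintegral_liminf_le (μ := volume) (u := atTop)
      (f := fun (L : ℝ) x => ENNReal.ofReal (Real.exp (-ε (dualPt d L (cell d L x)))))
      fun L => measurable_comp_cell (fun z => ENNReal.ofReal (Real.exp (-ε (dualPt d L z)))) L
    rw [hlim.liminf_eq] at h
    refine le_trans (lintegral_mono fun x => ?_) h
    exact (ENNReal.tendsto_ofReal (tendsto_exp_dualPt_cell hcont x)).liminf_eq.symm.le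
  have hfin : ∫⁻ x, ENNReal.ofReal (Real.exp (-ε x)) ≠ ∞ :=
    ne_top_of_le_ne_top ENNReal.ofReal_ne_top hfatou
  refine ⟨hfin, ?_⟩
  have hint : Integrable fun x => Real.exp (-ε x) := by
    refine ⟨hcont.aestronglyMeasurable, ?_⟩
    rw [hasFiniteIntegral_iff_ofReal (Eventually.of_forall fun _ => Real.exp_nonneg _)]
    exact hfin.lt_top
  rwa [ofReal_integral_eq_lintegral_ofReal hint
    (Eventually.of_forall fun _ => Real.exp_nonneg _)] at hlim

/-- Riemann sums over the punctured dual lattice of a function of `e^{-ε}` that blows up at most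
like `1 / ε` converge to the integral. -/
lemma tendsto_punctured_riemannSum (hd : 1 ≤ d) (hε_pos : ∀ k : Eu d, k ≠ 0 → 0 < ε k)
    (hcont : Continuous fun k => Real.exp (-ε k))
    {a η c : ℝ} (ha : 0 < a) (hη : 0 < η) (hηd : η < d)
    (hlow : ∀ k : Eu d, ‖k‖ ≤ 1 → a * ‖k‖ ^ η ≤ ε k) (hc : 0 < c)
    (hinf : ∀ k : Eu d, 1 ≤ ‖k‖ → c ≤ ε k)
    (hRiemann : Tendsto
      (fun L : ℝ => (L ^ d)⁻¹ * ∑' z : Fin d → ℤ, Real.exp (-ε (dualPt d L z)))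
      atTop (𝓝 (∫ k : Eu d, Real.exp (-ε k))))
    (hlat : ∀ L : ℝ, 0 < L → Summable fun z : Fin d → ℤ => Real.exp (-ε (dualPt d L z)))
    {Φ : ℝ → ℝ≥0∞} (hΦc : ContinuousOn Φ (Set.Ico 0 1)) {C : ℝ} (hC : 0 ≤ C)
    (hΦ : ∀ t : ℝ, 0 ≤ t → t < 1 → Φ t ≤ ENNReal.ofReal (C * (t / (1 - t)))) :
    Tendsto (fun L : ℝ => ENNReal.ofReal ((L ^ d)⁻¹) *
        ∑' z : Fin d → ℤ, if z = 0 then 0 else Φ (Real.exp (-ε (dualPt d L z)))) atTop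
      (𝓝 (∫⁻ x, Φ (Real.exp (-ε x)))) ∧ ∫⁻ x, Φ (Real.exp (-ε x)) ≠ ∞ := by
  obtain ⟨hfin, hlimexp⟩ := tendsto_lintegral_exp_cell hcont hRiemann hlat
  have : Nonempty (Fin d) := ⟨⟨0, hd⟩⟩
  have hae : ∀ᵐ x : Eu d, x ≠ 0 := by
    rw [ae_iff]
    simp
  have hlt : ∀ k : Eu d, k ≠ 0 → Real.exp (-ε k) < 1 := fun k hk =>
    Real.exp_lt_one_iff.2 (by linarith [hε_pos k hk])
  have hc1 : 0 < 1 - Real.exp (-c) := by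
    have : Real.exp (-c) < 1 := Real.exp_lt_one_iff.2 (by linarith)
    linarith
  set B : ℝ := d + 1 with hBdef
  have hB : 0 < B := by positivity
  have hB1 : 1 ≤ B := by
    rw [hBdef]
    linarith [Nat.cast_nonneg (α := ℝ) d]
  set H : Eu d → ℝ := fun x =>
    C * (B ^ η / a * (Metric.ball (0 : Eu d) (B + 1)).indicator (fun x => ‖x‖ ^ (-η)) x) with hHdef
  set K : ℝ := C * (1 - Real.exp (-c))⁻¹ with hKdef
  have hHint : Integrable H :=
    ((integrable_indicator_ball_norm_rpow hd hηd (B + 1)).const_mul _).const_mul _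
  have hHm : Measurable H := by
    refine ((Measurable.indicator ?_ measurableSet_ball).const_mul _).const_mul _
    fun_prop
  have hH0 : ∀ x, 0 ≤ H x := fun x => mul_nonneg hC
    (mul_nonneg (by positivity) (Set.indicator_nonneg (fun y _ => by positivity) x))
  have hdom : ∀ x k : Eu d, x ≠ 0 → k ≠ 0 → ‖x‖ ≤ B * ‖k‖ → Φ (Real.exp (-ε k)) ≤
      ENNReal.ofReal (H x) + ENNReal.ofReal K * ENNReal.ofReal (Real.exp (-ε k)) := by
    intro x k hx hk hxk
    rw [← ENNReal.ofReal_mul (by positivity), ← ENNReal.ofReal_add (hH0 x) (by positivity)]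
    refine (hΦ _ (Real.exp_nonneg _) (hlt k hk)).trans (ENNReal.ofReal_le_ofReal ?_)
    have := mul_le_mul_of_nonneg_left
      (exp_neg_div_le_of_norm_le hε_pos ha hη hlow hc hinf hB hx hk hxk) hC
    refine this.trans (le_of_eq ?_)
    rw [hHdef, hKdef]
    ring
  have key := tendsto_lintegral_of_le_add_mul (μ := volume) (l := atTop)
    (F := fun (L : ℝ) (x : Eu d) =>
      if cell d L x = 0 then 0 else Φ (Real.exp (-ε (dualPt d L (cell d L x)))))
    (f := fun (L : ℝ) x => ENNReal.ofReal (Real.exp (-ε (dualPt d L (cell d L x)))))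
    (F₀ := fun x => Φ (Real.exp (-ε x)))
    (f₀ := fun x => ENNReal.ofReal (Real.exp (-ε x)))
    (H := fun x => ENNReal.ofReal (H x)) (K := ENNReal.ofReal K)
    (fun L => measurable_comp_cell
      (fun z => if z = 0 then 0 else Φ (Real.exp (-ε (dualPt d L z)))) L)
    (fun L => measurable_comp_cell (fun z => ENNReal.ofReal (Real.exp (-ε (dualPt d L z)))) L)
    (ENNReal.measurable_ofReal.comp hcont.measurable) (ENNReal.measurable_ofReal.comp hHm)
    (hHint.lintegral_lt_top.ne) hfin ENNReal.ofReal_ne_top ?_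
    (Eventually.of_forall fun x => ENNReal.tendsto_ofReal (tendsto_exp_dualPt_cell hcont x))
    hlimexp ?_ ?_
  · refine ⟨key.1.congr' ?_, key.2⟩
    filter_upwards [eventually_gt_atTop 0] with L hL
    exact lintegral_cell d hL fun z => if z = 0 then 0 else Φ (Real.exp (-ε (dualPt d L z)))
  · filter_upwards [hae] with x hx
    have hne : ∀ᶠ L : ℝ in atTop, cell d L x ≠ 0 := by
      filter_upwards [(tendsto_dualPt_cell d x).eventually_ne hx] with L hL h0
      exact hL (by rw [h0, dualPt_zero])
    have hΦx : Tendsto Φ (𝓝[Set.Ico 0 1] (Real.exp (-ε x))) (𝓝 (Φ (Real.exp (-ε x)))) :=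
      hΦc _ ⟨Real.exp_nonneg _, hlt x hx⟩
    have hin : Tendsto (fun L : ℝ => Real.exp (-ε (dualPt d L (cell d L x)))) atTop
        (𝓝[Set.Ico 0 1] (Real.exp (-ε x))) := by
      refine tendsto_nhdsWithin_iff.2 ⟨tendsto_exp_dualPt_cell hcont x, ?_⟩
      filter_upwards [hne, eventually_gt_atTop 0] with L hL hL0
      exact ⟨Real.exp_nonneg _, hlt _ (dualPt_ne_zero d hL0 hL)⟩
    refine (hΦx.comp hin).congr' ?_
    filter_upwards [hne] with L hL
    rw [if_neg hL, Function.comp_apply]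
  · filter_upwards [eventually_gt_atTop 0] with L hL
    filter_upwards [hae] with x hx
    split_ifs with h
    · exact zero_le
    · exact hdom x _ hx (dualPt_ne_zero d hL h) (norm_le_of_cell_ne_zero d hL h)
  · filter_upwards [hae] with x hx
    exact hdom x x hx hx (le_mul_of_one_le_left (norm_nonneg x) hB1)

lemma rhoC_eq_toReal_lintegral (hcont : Continuous fun k => Real.exp (-ε k)) {α : ℕ → ℝ}
    (hfin : ∫⁻ x, cycleSeries α (Real.exp (-ε x)) ≠ ∞) :
    rhoC d ε α = (∫⁻ x, cycleSeries α (Real.exp (-ε x))).toReal := by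
  have hterm : ∫⁻ x, cycleSeries α (Real.exp (-ε x)) =
      ∑' j : ℕ, ∫⁻ x, ENNReal.ofReal (Real.exp (-α (j + 1)) * Real.exp (-ε x) ^ (j + 1)) := by
    unfold cycleSeries
    exact lintegral_tsum fun j => (ENNReal.measurable_ofReal.comp
      (continuous_const.mul (hcont.pow (j + 1))).measurable).aemeasurable
  rw [hterm] at hfin ⊢
  rw [ENNReal.tsum_toReal_eq (ENNReal.ne_top_of_tsum_ne_top hfin), rhoC]
  refine tsum_congr fun j => ?_
  rw [← integral_const_mul, ← integral_eq_lintegral_of_nonneg_ae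
    (f := fun x => Real.exp (-α (j + 1)) * Real.exp (-ε x) ^ (j + 1))
    (Eventually.of_forall fun x => by positivity)
    (continuous_const.mul (hcont.pow (j + 1))).aestronglyMeasurable]
  refine integral_congr_ae (Eventually.of_forall fun x => ?_)
  simp only
  rw [← Real.exp_nat_mul]
  congr 2
  push_cast
  ring

lemma tsum_modeCycle (α : ℕ → ℝ) (L : ℝ) :
    ∑' k, ∑' j, modeCycle d ε α L k j =
      ∑' z : Fin d → ℤ, if z = 0 then 0 else cycleSeries α (Real.exp (-ε (dualPt d L z))) := by
  refine tsum_congr fun z => ?_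
  by_cases hz : z = 0
  · simp [modeCycle, hz]
  · simp [modeCycle, hz, cycleSeries]

lemma inv_one_sub_exp_neg_le {e : ℝ} (he : 0 < e) : (1 - Real.exp (-e))⁻¹ ≤ 1 + e⁻¹ := by
  have h1 : Real.exp (-e) < 1 := Real.exp_lt_one_iff.2 (by linarith)
  have h2 : (1 - Real.exp (-e))⁻¹ = 1 + Real.exp (-e) / (1 - Real.exp (-e)) := by
    have : 1 - Real.exp (-e) ≠ 0 := by linarith
    field_simp
    ring
  rw [h2]
  linarith [exp_neg_div_le_inv he]

lemma inv_one_sub_exp_neg_dualPt_le (hε_pos : ∀ k : Eu d, k ≠ 0 → 0 < ε k) {a η c : ℝ} (ha : 0 < a)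
    (hη : 0 < η) (hlow : ∀ k : Eu d, ‖k‖ ≤ 1 → a * ‖k‖ ^ η ≤ ε k) (hc : 0 < c)
    (hinf : ∀ k : Eu d, 1 ≤ ‖k‖ → c ≤ ε k) {L : ℝ} (hL : 0 < L) {z : Fin d → ℤ} (hz : z ≠ 0) :
    (1 - Real.exp (-ε (dualPt d L z)))⁻¹ ≤ 1 + c⁻¹ + a⁻¹ * L ^ η := by
  have hk := dualPt_ne_zero d hL hz
  have h1 := inv_one_sub_exp_neg_le (hε_pos _ hk)
  have h0 : 0 < c⁻¹ := by positivity
  have h0' : 0 ≤ a⁻¹ * L ^ η := by positivity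
  rcases le_total ‖dualPt d L z‖ 1 with h | h
  · have h2 : a * (L ^ η)⁻¹ ≤ ε (dualPt d L z) := by
      refine le_trans ?_ (hlow _ h)
      rw [← Real.inv_rpow hL.le, ← one_div]
      gcongr
      exact one_div_le_norm_dualPt d hL hz
    have h3 := inv_anti₀ (by positivity) h2
    rw [mul_inv, inv_inv] at h3
    linarith
  · have h3 := inv_anti₀ hc (hinf _ h)
    linarith

lemma tsum_succ_mul_modeCycle_le (hε_pos : ∀ k : Eu d, k ≠ 0 → 0 < ε k) {α : ℕ → ℝ} {C : ℝ}
    (hC : ∀ j : ℕ, 1 ≤ j → Real.exp (-α j) ≤ C) {L Q : ℝ} (hL : 0 < L) (hQ0 : 0 ≤ Q)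
    (hQ : ∀ z : Fin d → ℤ, z ≠ 0 → (1 - Real.exp (-ε (dualPt d L z)))⁻¹ ≤ Q) :
    ∑' k, ∑' j : ℕ, ((j + 1 : ℕ) : ℝ≥0∞) * modeCycle d ε α L k j ≤
      ENNReal.ofReal (C * Q) * ∑' z : Fin d → ℤ, if z = 0 then 0 else
        ENNReal.ofReal (Real.exp (-ε (dualPt d L z)) / (1 - Real.exp (-ε (dualPt d L z)))) := by
  have hC0 : 0 ≤ C := (Real.exp_nonneg _).trans (hC 1 le_rfl)
  rw [← ENNReal.tsum_mul_left]
  refine ENNReal.tsum_le_tsum fun z => ?_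
  by_cases hz : z = 0
  · simp [modeCycle, hz]
  · have hlt : Real.exp (-ε (dualPt d L z)) < 1 :=
      Real.exp_lt_one_iff.2 (by linarith [hε_pos _ (dualPt_ne_zero d hL hz)])
    have h1 : 0 < 1 - Real.exp (-ε (dualPt d L z)) := by linarith
    simp only [modeCycle, if_neg hz]
    refine (tsum_succ_mul_cycle_le hC (Real.exp_nonneg _) hlt).trans ?_
    rw [← ENNReal.ofReal_mul (by positivity)]
    refine ENNReal.ofReal_le_ofReal ?_
    rw [mul_assoc, sq, ← div_div, div_eq_inv_mul _ (1 - _)]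
    gcongr
    exact hQ z hz

end Dispersion

section Volume

variable {d : ℕ}

lemma eventually_ne_top_of_tendsto_ofReal_mul {F : ℝ → ℝ≥0∞} {A : ℝ≥0∞}
    (h : Tendsto (fun L : ℝ => ENNReal.ofReal ((L ^ d)⁻¹) * F L) atTop (𝓝 A)) (hA : A ≠ ∞) :
    ∀ᶠ L in atTop, F L ≠ ∞ := by
  filter_upwards [h.eventually_ne hA, eventually_gt_atTop 0] with L h1 hL h2
  rw [h2, ENNReal.mul_top (ENNReal.ofReal_pos.2 (by positivity)).ne'] at h1
  exact h1 rfl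

lemma tendsto_toReal_div_of_tendsto_ofReal_mul {F : ℝ → ℝ≥0∞} {A : ℝ≥0∞}
    (h : Tendsto (fun L : ℝ => ENNReal.ofReal ((L ^ d)⁻¹) * F L) atTop (𝓝 A)) (hA : A ≠ ∞) :
    Tendsto (fun L => (F L).toReal / L ^ d) atTop (𝓝 A.toReal) := by
  refine ((ENNReal.tendsto_toReal hA).comp h).congr' ?_
  filter_upwards [eventually_gt_atTop 0] with L hL
  rw [Function.comp_apply, ENNReal.toReal_mul, ENNReal.toReal_ofReal (by positivity),
    inv_mul_eq_div]

lemma tendsto_const_add_mul_rpow_div_pow (hd : 1 ≤ d) (A B : ℝ) {η : ℝ} (hη : η < d) :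
    Tendsto (fun L : ℝ => (A + B * L ^ η) / L ^ d) atTop (𝓝 0) := by
  have h1 : Tendsto (fun L : ℝ => A / L ^ d) atTop (𝓝 0) :=
    tendsto_const_nhds.div_atTop (tendsto_pow_atTop (by omega))
  have h2 := (tendsto_rpow_neg_atTop (sub_pos.2 hη)).const_mul B
  have h := h1.add h2
  rw [mul_zero, add_zero] at h
  refine h.congr' ?_
  filter_upwards [eventually_gt_atTop 0] with L hL
  rw [neg_sub, Real.rpow_sub hL, Real.rpow_natCast]
  ring

end Volume

/-- Proposition 4.3 (a): the probability measures
`μ_Λ = Ž⁻¹ ∑_{N≥0} Ž(N) δ_{N/|Λ|}` converge weakly, as `L → ∞`, to the Dirac measure at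
the critical density `ρ_c`: for every bounded continuous `g : ℝ → ℝ`,
`∫ g dμ_Λ → g(ρ_c)`. -/
theorem statement11
    (d : ℕ) (hd : 1 ≤ d) (ε : Eu d → ℝ)
    -- assumptions on the dispersion relation `ε`
    (hε0 : ε 0 = 0) (hε_nonneg : ∀ k, 0 ≤ ε k) (hε_pos : ∀ k : Eu d, k ≠ 0 → 0 < ε k)
    (hε_uc : UniformContinuous fun k => Real.exp (-ε k))
    (hε_low : ∃ a > (0:ℝ), ∃ η : ℝ, 0 < η ∧ η < d ∧
      ∀ k : Eu d, ‖k‖ ≤ 1 → a * ‖k‖ ^ η ≤ ε k)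
    (hε_inf : ∀ δ : ℝ, 0 < δ → ∃ c > (0:ℝ), ∀ k : Eu d, δ ≤ ‖k‖ → c ≤ ε k)
    -- convergence of the Riemann sums `|Λ|⁻¹ ∑_{k∈Λ*} e^{-ε(k)} → ∫ e^{-ε(k)} dk`
    (hRiemann : Tendsto
      (fun L : ℝ => (L ^ d)⁻¹ * ∑' z : Fin d → ℤ, Real.exp (-ε (dualPt d L z)))
      atTop (𝓝 (∫ k : Eu d, Real.exp (-ε k))))
    -- bounded cycle weights: `sup_j e^{-α_j} < ∞`
    (α : ℕ → ℝ) (hα_bdd : ∃ C : ℝ, ∀ j : ℕ, 1 ≤ j → Real.exp (-α j) ≤ C)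
    -- summability of `e^{-ε}` over the dual lattices (so each `μ_Λ` is well defined)
    (hlat : ∀ L : ℝ, 0 < L → Summable fun z : Fin d → ℤ => Real.exp (-ε (dualPt d L z))) :
    ∀ g : BoundedContinuousFunction ℝ ℝ,
      Tendsto (fun L : ℝ =>
          (∑' N : ℕ, (Zcheck d ε α L N).toReal * g ((N : ℝ) / L ^ d)) /
            (∑' N : ℕ, (Zcheck d ε α L N).toReal))
        atTop (𝓝 (g (rhoC d ε α))) := by
  intro g
  obtain ⟨a, ha, η, hη, hηd, hlow⟩ := hε_low
  obtain ⟨c, hc, hinf⟩ := hε_inf 1 one_pos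
  obtain ⟨C, hC⟩ := hα_bdd
  have hC0 : 0 ≤ C := (Real.exp_nonneg _).trans (hC 1 le_rfl)
  have hcont := hε_uc.continuous
  obtain ⟨hmean, hmean_fin⟩ := tendsto_punctured_riemannSum hd hε_pos hcont ha hη hηd hlow hc hinf
    hRiemann hlat (continuousOn_cycleSeries hC) hC0 fun t h0 h1 => cycleSeries_le hC h0 h1
  obtain ⟨hbound, hbound_fin⟩ := tendsto_punctured_riemannSum hd hε_pos hcont ha hη hηd hlow hc
    hinf hRiemann hlat (Φ := fun t => ENNReal.ofReal (t / (1 - t)))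
    (ENNReal.continuous_ofReal.comp_continuousOn
      (continuousOn_id.div (by fun_prop) fun t ht => (sub_pos.2 ht.2).ne')) zero_le_one
    fun t _ _ => by rw [one_mul]
  have hρ := rhoC_eq_toReal_lintegral hcont hmean_fin
  simp only [← tsum_modeCycle] at hmean
  set m : ℝ → ℝ≥0∞ := fun L => ∑' k, ∑' j, modeCycle d ε α L k j with hm_def
  set V : ℝ → ℝ≥0∞ := fun L => ∑' k, ∑' j : ℕ, ((j + 1 : ℕ) : ℝ≥0∞) * modeCycle d ε α L k j
    with hV_def
  set M : ℝ → ℝ≥0∞ := fun L => ∑' z : Fin d → ℤ, if z = 0 then 0 else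
    ENNReal.ofReal (Real.exp (-ε (dualPt d L z)) / (1 - Real.exp (-ε (dualPt d L z)))) with hM_def
  have hVM : ∀ L : ℝ, 0 < L → V L ≤ ENNReal.ofReal (C * (1 + c⁻¹ + a⁻¹ * L ^ η)) * M L :=
    fun L hL => tsum_succ_mul_modeCycle_le hε_pos hC hL (by positivity) fun z hz =>
      inv_one_sub_exp_neg_dualPt_le hε_pos ha hη hlow hc hinf hL hz
  have hm_fin : ∀ᶠ L in atTop, m L ≠ ∞ := eventually_ne_top_of_tendsto_ofReal_mul hmean hmean_fin
  have hM_fin : ∀ᶠ L in atTop, M L ≠ ∞ := eventually_ne_top_of_tendsto_ofReal_mul hbound hbound_fin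
  have hm_lim : Tendsto (fun L => (m L).toReal / L ^ d) atTop (𝓝 (rhoC d ε α)) := by
    rw [hρ]
    exact tendsto_toReal_div_of_tendsto_ofReal_mul hmean hmean_fin
  have hM_lim := tendsto_toReal_div_of_tendsto_ofReal_mul hbound hbound_fin
  have hV_lim : Tendsto (fun L => (V L).toReal / (L ^ d) ^ 2) atTop (𝓝 0) := by
    have h := ((tendsto_const_add_mul_rpow_div_pow hd (1 + c⁻¹) a⁻¹ hηd).const_mul C).mul hM_lim
    rw [mul_zero, zero_mul] at h
    refine tendsto_of_tendsto_of_tendsto_of_le_of_le' tendsto_const_nhds h ?_ ?_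
    · filter_upwards [eventually_gt_atTop 0] with L hL
      positivity
    · filter_upwards [eventually_gt_atTop 0, hM_fin] with L hL hML
      have h1 := ENNReal.toReal_mono (ENNReal.mul_ne_top ENNReal.ofReal_ne_top hML) (hVM L hL)
      rw [ENNReal.toReal_mul, ENNReal.toReal_ofReal (by positivity)] at h1
      calc (V L).toReal / (L ^ d) ^ 2
          ≤ C * (1 + c⁻¹ + a⁻¹ * L ^ η) * (M L).toReal / (L ^ d) ^ 2 := by gcongr
        _ = C * ((1 + c⁻¹ + a⁻¹ * L ^ η) / L ^ d) * ((M L).toReal / L ^ d) := by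
          field_simp
  rw [Metric.tendsto_nhds]
  intro e he
  obtain ⟨K, -, hK⟩ := exists_quadratic_bound g (rhoC d ε α) (half_pos he)
  have hlim : Tendsto (fun L => e / 2 + K * (((m L).toReal / L ^ d - rhoC d ε α) ^ 2 +
      (V L).toReal / (L ^ d) ^ 2)) atTop (𝓝 (e / 2)) := by
    simpa using ((((hm_lim.sub_const (rhoC d ε α)).pow 2).add hV_lim).const_mul K).const_add (e / 2)
  filter_upwards [hlim.eventually_lt_const (half_lt_self he), eventually_gt_atTop 0, hm_fin,
    hM_fin] with L hlt hL hmL hML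
  rw [Real.dist_eq]
  exact (abs_ratio_sub_le d ε α L hL hmL (ne_top_of_le_ne_top
    (ENNReal.mul_ne_top ENNReal.ofReal_ne_top hML) (hVM L hL)) g hK).trans_lt hlt
end
end
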